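/- Let Ω be a convex quasi-homogeneous affine domain in ℝⁿ with Ω ≠ ℝⁿ, such that Aut(Ω) is irreducible and the limit set Λ_{Aut⁰(Ω)} of the identity component of Aut(Ω) is nonempty. Then Ω is a semi-algebraic subset of ℝⁿ. -/

import Mathlib

open Matrix Set Filter Topology Pointwise

noncomputable section

/-- The affine action on ℝⁿ of an (n+1)×(n+1) invertible matrix in affine form
(ℝⁿ is identified with the hyperplane x_{n+1} = 1). -/
def affAct (n : ℕ) (g : GL (Fin (n + 1)) ℝ) (x : Fin n → ℝ) : Fin n → ℝ :=
  fun i => (∑ j : Fin n, g.val i.castSucc j.castSucc * x j) + g.val i.castSucc (Fin.last n)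

/-- A matrix in GL(n+1,ℝ) has affine form if its last row is (0, …, 0, 1). -/
def IsAffineForm (n : ℕ) (g : GL (Fin (n + 1)) ℝ) : Prop :=
  (∀ j : Fin n, g.val (Fin.last n) j.castSucc = 0) ∧ g.val (Fin.last n) (Fin.last n) = 1

/-- Aut(Ω): the group (here: set) of affine transformations of ℝⁿ preserving Ω,
realized as affine-form matrices in GL(n+1,ℝ). -/
def AutSet (n : ℕ) (Ω : Set (Fin n → ℝ)) : Set (GL (Fin (n + 1)) ℝ) :=
  {g | IsAffineForm n g ∧ affAct n g '' Ω = Ω}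

/-- Aut⁰(Ω): the identity component of Aut(Ω). -/
def AutIdComp (n : ℕ) (Ω : Set (Fin n → ℝ)) : Set (GL (Fin (n + 1)) ℝ) :=
  connectedComponentIn (AutSet n Ω) 1

/-- The limit set Λ_G of a subset G of Aut(Ω). -/
def limitSet (n : ℕ) (Ω : Set (Fin n → ℝ)) (G : Set (GL (Fin (n + 1)) ℝ)) :
    Set (Fin n → ℝ) :=
  {ξ | ξ ∈ frontier Ω ∧ ∃ x ∈ Ω, ∃ u : ℕ → GL (Fin (n + 1)) ℝ,
    (∀ k, u k ∈ G) ∧ Filter.Tendsto (fun k => affAct n (u k) x) Filter.atTop (nhds ξ)}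

/-- Ω is a convex affine domain: a nonempty open convex subset of ℝⁿ. -/
def IsConvexDomain (n : ℕ) (Ω : Set (Fin n → ℝ)) : Prop :=
  Ω.Nonempty ∧ IsOpen Ω ∧ Convex ℝ Ω

/-- Ω contains no complete affine line. -/
def HasNoLine (n : ℕ) (Ω : Set (Fin n → ℝ)) : Prop :=
  ¬ ∃ x ∈ Ω, ∃ v : Fin n → ℝ, v ≠ 0 ∧ ∀ t : ℝ, x + t • v ∈ Ω

/-- Ω is a properly convex affine domain. -/
def IsProperlyConvexDomain (n : ℕ) (Ω : Set (Fin n → ℝ)) : Prop :=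
  IsConvexDomain n Ω ∧ HasNoLine n Ω

/-- Ω is quasi-homogeneous: some compact K ⊆ Ω has ⋃_{g ∈ Aut(Ω)} g(K) = Ω. -/
def IsQuasiHomogeneous (n : ℕ) (Ω : Set (Fin n → ℝ)) : Prop :=
  ∃ K : Set (Fin n → ℝ), IsCompact K ∧ K ⊆ Ω ∧
    (⋃ g ∈ AutSet n Ω, affAct n g '' K) = Ω

/-- Aut(Ω) is irreducible: it preserves no nonempty proper affine subspace of ℝⁿ. -/
def IsIrreducibleAut (n : ℕ) (Ω : Set (Fin n → ℝ)) : Prop :=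
  ¬ ∃ S : AffineSubspace ℝ (Fin n → ℝ), (S : Set (Fin n → ℝ)).Nonempty ∧
      (S : Set (Fin n → ℝ)) ≠ Set.univ ∧
      ∀ g ∈ AutSet n Ω, affAct n g '' (S : Set (Fin n → ℝ)) = (S : Set (Fin n → ℝ))

/-- The asymptotic cone AC(Ω). -/
def asympCone (n : ℕ) (Ω : Set (Fin n → ℝ)) : Set (Fin n → ℝ) :=
  {u | ∀ x ∈ Ω, ∀ t : ℝ, 0 ≤ t → x + t • u ∈ Ω}

/-- Ω is a cone with some vertex v. -/
def IsCone (n : ℕ) (Ω : Set (Fin n → ℝ)) : Prop :=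
  ∃ v : Fin n → ℝ, ∀ x ∈ Ω, ∀ t : ℝ, 0 < t → v + t • (x - v) ∈ Ω

/-- Two subsets of ℝⁿ are affinely equivalent. -/
def AffinelyEquivalent (n : ℕ) (Ω Ω' : Set (Fin n → ℝ)) : Prop :=
  ∃ e : (Fin n → ℝ) ≃ᵃ[ℝ] (Fin n → ℝ), e '' Ω = Ω'

/-- Γ acts freely on Ω. -/
def ActsFreely (n : ℕ) (Ω : Set (Fin n → ℝ)) (Γ : Set (GL (Fin (n + 1)) ℝ)) : Prop :=
  ∀ γ ∈ Γ, γ ≠ 1 → ∀ x ∈ Ω, affAct n γ x ≠ x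

/-- Γ acts properly discontinuously on Ω. -/
def ActsProperlyDiscontinuously (n : ℕ) (Ω : Set (Fin n → ℝ))
    (Γ : Set (GL (Fin (n + 1)) ℝ)) : Prop :=
  ∀ K L : Set (Fin n → ℝ), K ⊆ Ω → L ⊆ Ω → IsCompact K → IsCompact L →
    {γ ∈ Γ | (affAct n γ '' K ∩ L).Nonempty}.Finite

/-- Γ acts cocompactly on Ω. -/
def ActsCocompactly (n : ℕ) (Ω : Set (Fin n → ℝ)) (Γ : Set (GL (Fin (n + 1)) ℝ)) : Prop :=
  ∃ K : Set (Fin n → ℝ), IsCompact K ∧ K ⊆ Ω ∧ (⋃ γ ∈ Γ, affAct n γ '' K) = Ω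

/-- The linear part of an affine-form matrix has determinant one. -/
def LinearPartDetOne (n : ℕ) (g : GL (Fin (n + 1)) ℝ) : Prop :=
  (Matrix.of fun i j : Fin n => g.val i.castSucc j.castSucc).det = 1

/-- S ⊆ ℝⁿ is semi-algebraic: a finite union of finite intersections of zero sets and
positivity sets of real polynomials. -/
def IsSemialgebraic (n : ℕ) (S : Set (Fin n → ℝ)) : Prop :=
  ∃ (N M : ℕ) (p : Fin N → Fin M → MvPolynomial (Fin n) ℝ) (sgn : Fin N → Fin M → Bool),
    S = ⋃ i : Fin N, ⋂ j : Fin M,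
      {x : Fin n → ℝ | if sgn i j then MvPolynomial.eval x (p i j) = 0
        else 0 < MvPolynomial.eval x (p i j)}

theorem exists_orderIso_bump_aux {A B c d : ℝ} (hAc : A < c) (hcd : c ≤ d) (hdB : d < B) :
    ∃ ψ : ℝ ≃o ℝ, ψ c = d ∧ ∀ u, u ≤ A ∨ B ≤ u → ψ u = u := by
  have h1 : 0 < c - A := by linarith
  have h2 : 0 < B - c := by linarith
  have h3 : 1 ≤ (d - A) / (c - A) := by rw [le_div_iff₀ h1]; linarith
  have h4 : (B - d) / (B - c) ≤ 1 := by rw [div_le_iff₀ h2]; linarith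
  have h5 : 0 < (B - d) / (B - c) := by apply div_pos <;> linarith
  set k := (d - A) / (c - A) with hk
  set l := (B - d) / (B - c) with hl
  have hkc : k * (c - A) = d - A := by rw [hk]; field_simp
  have hlc : l * (B - c) = B - d := by rw [hl]; field_simp
  let f : ℝ → ℝ := fun u => max u (min (A + k * (u - A)) (B - l * (B - u)))
  have hf : StrictMono f := by
    intro u v huv
    have i1 := mul_lt_mul_of_pos_left huv (show 0 < k by linarith)
    have i2 := mul_lt_mul_of_pos_left huv h5
    exact max_lt_max huv (min_lt_min (by linarith) (by linarith))
  have hfix : ∀ u, u ≤ A ∨ B ≤ u → f u = u := by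
    intro u hu
    apply max_eq_left
    rcases hu with hu | hu
    · apply (min_le_left _ _).trans
      nlinarith
    · apply (min_le_right _ _).trans
      nlinarith
  have hcont : Continuous f := by fun_prop
  have hsurj : Function.Surjective f := by
    apply hcont.surjective
    · apply tendsto_id.congr'
      filter_upwards [eventually_ge_atTop B] with u hu
      exact (hfix u (Or.inr hu)).symm
    · apply tendsto_id.congr'
      filter_upwards [eventually_le_atBot A] with u hu
      exact (hfix u (Or.inl hu)).symm
  refine ⟨hf.orderIsoOfSurjective f hsurj, ?_, ?_⟩
  · show f c = d
    have e1 : A + k * (c - A) = d := by linarith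
    have e2 : B - l * (B - c) = d := by linarith
    simp only [f, e1, e2, min_self]
    exact max_eq_right hcd
  · exact hfix

theorem exists_orderIso_bump {A B c d : ℝ} (hAc : A < c) (hcB : c < B) (hAd : A < d)
    (hdB : d < B) :
    ∃ ψ : ℝ ≃o ℝ, ψ c = d ∧ ∀ u, u ≤ A ∨ B ≤ u → ψ u = u := by
  rcases le_total c d with h | h
  · exact exists_orderIso_bump_aux hAc h hdB
  · obtain ⟨ψ, h1, h2⟩ := exists_orderIso_bump_aux hAd h hcB
    refine ⟨ψ.symm, by rw [← h1]; simp, fun u hu => ?_⟩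
    rw [OrderIso.symm_apply_eq, h2 u hu]

theorem gap_matching_of_strictMonoOn {p q : ℝ → ℝ} (hq : Continuous q) (φ : ℝ ≃o ℝ)
    {a b : ℝ} (hab : a < b) (hp : Continuous p)
    (hpm : StrictMonoOn p (Icc a b)) (hqm : StrictMonoOn q (Icc (φ a) (φ b)))
    (ha : SignType.sign (p a) = SignType.sign (q (φ a)))
    (hb : SignType.sign (p b) = SignType.sign (q (φ b))) :
    (∀ t ∈ Ioo a b, SignType.sign (p t) = SignType.sign (q (φ t))) ∨
    ∃ c ∈ Ioo a b, p c = 0 ∧ q (φ c) ≠ 0 ∧ ∃ ψ : ℝ ≃o ℝ,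
      (∀ u, u ≤ φ a ∨ φ b ≤ u → ψ u = u) ∧
      ∀ t ∈ Ioo a b, SignType.sign (p t) = SignType.sign (q (ψ (φ t))) := by
  have hmem : ∀ t ∈ Ioo a b, φ t ∈ Ioo (φ a) (φ b) := fun t ht => by simpa using ht
  have hA : φ a < φ b := by simpa using hab
  rcases le_or_gt 0 (p a) with h0 | h0
  · left
    intro t ht
    have h1 : 0 ≤ q (φ a) := by
      rw [← sign_nonneg_iff, ← ha, sign_nonneg_iff]; exact h0
    have h2 := hpm (left_mem_Icc.2 hab.le) (Ioo_subset_Icc_self ht) ht.1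
    have h3 := hqm (left_mem_Icc.2 hA.le) (Ioo_subset_Icc_self (hmem t ht)) (hmem t ht).1
    rw [sign_pos (by linarith), sign_pos (by linarith)]
  rcases le_or_gt (p b) 0 with h0' | h0'
  · left
    intro t ht
    have h1 : q (φ b) ≤ 0 := by
      rw [← sign_nonpos_iff, ← hb, sign_nonpos_iff]; exact h0'
    have h2 := hpm (Ioo_subset_Icc_self ht) (right_mem_Icc.2 hab.le) ht.2
    have h3 := hqm (Ioo_subset_Icc_self (hmem t ht)) (right_mem_Icc.2 hA.le) (hmem t ht).2
    rw [sign_neg (by linarith), sign_neg (by linarith)]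
  have hqa : q (φ a) < 0 := by
    rw [sign_neg h0] at ha; exact sign_eq_neg_one_iff.1 ha.symm
  have hqb : 0 < q (φ b) := by
    rw [sign_pos h0'] at hb; exact sign_eq_one_iff.1 hb.symm
  obtain ⟨c, hc, hc0⟩ := intermediate_value_Ioo hab.le hp.continuousOn ⟨h0, h0'⟩
  obtain ⟨d, hd, hd0⟩ := intermediate_value_Ioo hA.le hq.continuousOn ⟨hqa, hqb⟩
  have key : ∀ ψ : ℝ ≃o ℝ, ψ (φ c) = d → (∀ u, u ≤ φ a ∨ φ b ≤ u → ψ u = u) →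
      ∀ t ∈ Ioo a b, SignType.sign (p t) = SignType.sign (q (ψ (φ t))) := by
    intro ψ h1 h2 t ht
    have e1 : φ a < ψ (φ t) := by
      rw [← h2 (φ a) (Or.inl le_rfl)]; simpa using ht.1
    have e2 : ψ (φ t) < φ b := by
      rw [← h2 (φ b) (Or.inr le_rfl)]; simpa using ht.2
    rcases lt_trichotomy t c with h | h | h
    · have i1 := hpm (Ioo_subset_Icc_self ht) (Ioo_subset_Icc_self hc) h
      have i2 := hqm ⟨e1.le, e2.le⟩ (Ioo_subset_Icc_self hd)
        (show ψ (φ t) < d by rw [← h1]; simpa using h)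
      rw [sign_neg (by linarith), sign_neg (by linarith)]
    · rw [h, h1, hc0, hd0]
    · have i1 := hpm (Ioo_subset_Icc_self hc) (Ioo_subset_Icc_self ht) h
      have i2 := hqm (Ioo_subset_Icc_self hd) ⟨e1.le, e2.le⟩
        (show d < ψ (φ t) by rw [← h1]; simpa using h)
      rw [sign_pos (by linarith), sign_pos (by linarith)]
  by_cases hcd : φ c = d
  · left
    exact key (OrderIso.refl ℝ) hcd (fun _ _ => rfl)
  · right
    have hφc := hmem c hc
    obtain ⟨ψ, h1, h2⟩ := exists_orderIso_bump hφc.1 hφc.2 hd.1 hd.2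
    refine ⟨c, hc, hc0, fun h => hcd ?_, ψ, h2, key ψ h1 h2⟩
    exact hqm.injOn (Ioo_subset_Icc_self hφc) (Ioo_subset_Icc_self hd) (h.trans hd0.symm)

theorem sign_eq_of_forall_ne_zero {f : ℝ → ℝ} (hf : Continuous f) {a b : ℝ}
    (h : ∀ t ∈ Ioo a b, f t ≠ 0) {s t : ℝ} (hs : s ∈ Ioo a b) (ht : t ∈ Ioo a b) :
    SignType.sign (f s) = SignType.sign (f t) := by
  have key : ∀ x ∈ Ioo a b, ∀ y ∈ Ioo a b, f x < 0 → 0 < f y → False := by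
    intro x hx y hy h1 h2
    obtain ⟨z, hz, hz0⟩ := isPreconnected_Ioo.intermediate_value hx hy hf.continuousOn
      ⟨h1.le, h2.le⟩
    exact h z hz hz0
  rcases lt_or_gt_of_ne (h s hs) with h1 | h1 <;> rcases lt_or_gt_of_ne (h t ht) with h2 | h2
  · rw [sign_neg h1, sign_neg h2]
  · exact (key s hs t ht h1 h2).elim
  · exact (key t ht s hs h2 h1).elim
  · rw [sign_pos h1, sign_pos h2]

theorem exists_left_gap {W T : Set ℝ} (hW : W.Finite) (hWT : W ⊆ T) {t : ℝ}
    (hT : ∃ α ∈ T, α < t) : ∃ a ∈ T, a < t ∧ ∀ w ∈ W, w < t → w ≤ a := by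
  obtain ⟨α, hα, hαt⟩ := hT
  obtain ⟨a, ha, hmax⟩ := Set.exists_max_image (insert α (W ∩ Iio t)) id
    ((hW.inter_of_left _).insert α) (insert_nonempty _ _)
  refine ⟨a, ?_, ?_, fun w hw hwt => hmax w (Or.inr ⟨hw, hwt⟩)⟩
  · rcases ha with rfl | ha
    exacts [hα, hWT ha.1]
  · rcases ha with rfl | ha
    exacts [hαt, ha.2]

theorem exists_right_gap {W T : Set ℝ} (hW : W.Finite) (hWT : W ⊆ T) {t : ℝ}
    (hT : ∃ β ∈ T, t < β) : ∃ b ∈ T, t < b ∧ ∀ w ∈ W, t < w → b ≤ w := by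
  obtain ⟨α, hα, hαt⟩ := hT
  obtain ⟨a, ha, hmax⟩ := Set.exists_min_image (insert α (W ∩ Ioi t)) id
    ((hW.inter_of_left _).insert α) (insert_nonempty _ _)
  refine ⟨a, ?_, ?_, fun w hw hwt => hmax w (Or.inr ⟨hw, hwt⟩)⟩
  · rcases ha with rfl | ha
    exacts [hα, hWT ha.1]
  · rcases ha with rfl | ha
    exacts [hαt, ha.2]

open Polynomial in
theorem eventually_sign_eval_atTop (P : ℝ[X]) (hP : 0 < P.natDegree) :
    ∀ᶠ t in atTop, SignType.sign (P.eval t) = SignType.sign P.leadingCoeff := by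
  have hd : 0 < P.degree := natDegree_pos_iff_degree_pos.1 hP
  have h0 : P.leadingCoeff ≠ 0 := leadingCoeff_ne_zero.2 (by rintro rfl; simp at hP)
  rcases lt_or_gt_of_ne h0 with h | h
  · filter_upwards [(P.tendsto_atBot_of_leadingCoeff_nonpos hd h.le).eventually_lt_atBot 0]
      with t ht
    rw [sign_neg h, sign_neg ht]
  · filter_upwards [(P.tendsto_atTop_of_leadingCoeff_nonneg hd h.le).eventually_gt_atTop 0]
      with t ht
    rw [sign_pos h, sign_pos ht]

open Polynomial in
theorem eventually_sign_eval_atBot (P : ℝ[X]) (hP : 0 < P.natDegree) :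
    ∀ᶠ t in atBot, SignType.sign (P.eval t) =
      SignType.sign ((-1) ^ P.natDegree * P.leadingCoeff) := by
  have h := eventually_sign_eval_atTop (P.comp (-X)) (by simpa [natDegree_comp] using hP)
  have hlc : (P.comp (-X)).leadingCoeff = (-1) ^ P.natDegree * P.leadingCoeff := by
    rw [leadingCoeff_comp (by simp)]
    simp [mul_comm]
  rw [hlc] at h
  filter_upwards [tendsto_neg_atBot_atTop.eventually h] with t ht
  simpa using ht

theorem sign_neg_congr {a b : ℝ} :
    SignType.sign (-a) = SignType.sign (-b) ↔ SignType.sign a = SignType.sign b := by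
  rw [Left.sign_neg, Left.sign_neg, neg_inj]

open Polynomial in
theorem exists_matching_extension (𝒲 : Set (ℝ[X] × ℝ[X])) (hfin : 𝒲.Finite) (P Q : ℝ[X])
    (hder : (derivative P, derivative Q) ∈ 𝒲) (hd : 0 < P.natDegree)
    (hdeg : Q.natDegree = P.natDegree)
    (hlc : SignType.sign P.leadingCoeff = SignType.sign Q.leadingCoeff) (φ : ℝ ≃o ℝ)
    (hφ : ∀ w ∈ 𝒲, ∀ t, SignType.sign (w.1.eval t) = SignType.sign (w.2.eval (φ t)))
    (hroot : ∀ w ∈ 𝒲, w.1 ≠ 0 → ∀ t, w.1.eval t = 0 →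
      SignType.sign (P.eval t) = SignType.sign (Q.eval (φ t))) :
    ∃ φ' : ℝ ≃o ℝ,
      (∀ w ∈ 𝒲, ∀ t, SignType.sign (w.1.eval t) = SignType.sign (w.2.eval (φ' t))) ∧
      ∀ t, SignType.sign (P.eval t) = SignType.sign (Q.eval (φ' t)) := by
  classical
  let T : (ℝ ≃o ℝ) → Set ℝ := fun φ =>
    {t | SignType.sign (P.eval t) = SignType.sign (Q.eval (φ t))}
  let W : Set ℝ := {t | ∃ w ∈ 𝒲, w.1 ≠ 0 ∧ w.1.eval t = 0}
  have hW : W.Finite := by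
    have : W ⊆ ⋃ w ∈ 𝒲, (w.1.roots.toFinset : Set ℝ) := by
      rintro t ⟨w, hw, hw0, ht⟩
      simp only [mem_iUnion]
      exact ⟨w, hw, by simp [hw0, ht]⟩
    exact (hfin.biUnion fun w _ => Finset.finite_toSet _).subset this
  induction hN : (P.roots.toFinset.filter (· ∉ T φ)).card using Nat.strong_induction_on
    generalizing φ with
  | _ N ih =>
  have hWT : W ⊆ T φ := by
    rintro t ⟨w, hw, hw0, ht⟩
    exact hroot w hw hw0 t ht
  by_cases hall : ∀ t, t ∈ T φ
  · exact ⟨φ, hφ, hall⟩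
  push Not at hall
  obtain ⟨t₀, ht₀⟩ := hall
  have hder0 : derivative P ≠ 0 := by
    intro h
    have := derivative_eq_zero.1 h
    omega
  have hbot : ∀ᶠ t in atBot, t ∈ T φ := by
    filter_upwards [eventually_sign_eval_atBot P hd, φ.tendsto_atBot.eventually
      (eventually_sign_eval_atBot Q (hdeg ▸ hd))] with t h1 h2
    show _ = _
    rw [h1, h2, hdeg, sign_mul, sign_mul, hlc]
  have htop : ∀ᶠ t in atTop, t ∈ T φ := by
    filter_upwards [eventually_sign_eval_atTop P hd, φ.tendsto_atTop.eventually
      (eventually_sign_eval_atTop Q (hdeg ▸ hd))] with t h1 h2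
    show _ = _
    rw [h1, h2, hlc]
  obtain ⟨a, haT, hat, haW⟩ := exists_left_gap hW hWT (t := t₀)
    ((hbot.and (eventually_lt_atBot t₀)).exists.imp fun _ h => h)
  obtain ⟨b, hbT, hbt, hbW⟩ := exists_right_gap hW hWT (t := t₀)
    ((htop.and (eventually_gt_atTop t₀)).exists.imp fun _ h => h)
  have hab : a < b := hat.trans hbt
  have hgap : ∀ w ∈ 𝒲, w.1 ≠ 0 → ∀ t ∈ Ioo a b, w.1.eval t ≠ 0 := by
    intro w hw hw0 t ht h0
    have htW : t ∈ W := ⟨w, hw, hw0, h0⟩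
    rcases lt_trichotomy t t₀ with h | h | h
    · exact absurd (haW t htW h) (not_le.2 ht.1)
    · exact ht₀ (h ▸ hWT htW)
    · exact absurd (hbW t htW h) (not_le.2 ht.2)
  have hdP : ∀ t ∈ Ioo a b, (derivative P).eval t ≠ 0 := hgap _ hder hder0
  have hφA : φ a < φ b := by simpa using hab
  have hmid : ∀ u ∈ Ioo (φ a) (φ b), φ.symm u ∈ Ioo a b := by
    intro u hu
    exact ⟨by rw [φ.lt_symm_apply]; exact hu.1, by rw [φ.symm_apply_lt]; exact hu.2⟩
  have mono_of : ∀ (R : ℝ[X]) (c d : ℝ), (∀ t ∈ Ioo c d, 0 < (derivative R).eval t) →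
      StrictMonoOn (fun t => R.eval t) (Icc c d) := by
    intro R c d h
    apply strictMonoOn_of_deriv_pos (convex_Icc c d) R.continuous.continuousOn
    intro t ht
    rw [interior_Icc] at ht
    rw [Polynomial.deriv]
    exact h t ht
  have main : (∀ t ∈ Ioo a b, SignType.sign (P.eval t) = SignType.sign (Q.eval (φ t))) ∨
      ∃ c ∈ Ioo a b, P.eval c = 0 ∧ Q.eval (φ c) ≠ 0 ∧ ∃ ψ : ℝ ≃o ℝ,
      (∀ u, u ≤ φ a ∨ φ b ≤ u → ψ u = u) ∧
      ∀ t ∈ Ioo a b, SignType.sign (P.eval t) = SignType.sign (Q.eval (ψ (φ t))) := by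
    have hsgn : ∀ t ∈ Ioo a b, SignType.sign ((derivative P).eval t) =
        SignType.sign ((derivative P).eval t₀) := fun t ht =>
      sign_eq_of_forall_ne_zero (derivative P).continuous hdP ht ⟨hat, hbt⟩
    have hsgnQ : ∀ u ∈ Ioo (φ a) (φ b), SignType.sign ((derivative Q).eval u) =
        SignType.sign ((derivative P).eval t₀) := by
      intro u hu
      have := hφ _ hder (φ.symm u)
      rw [φ.apply_symm_apply] at this
      rw [← this, hsgn _ (hmid u hu)]
    rcases lt_or_gt_of_ne (hdP t₀ ⟨hat, hbt⟩) with h | h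
    · have := gap_matching_of_strictMonoOn (p := fun t => (-P).eval t)
        (q := fun t => (-Q).eval t) (-Q).continuous φ hab (-P).continuous
        (mono_of _ _ _ fun t ht => by
          rw [derivative_neg, eval_neg, neg_pos, ← sign_eq_neg_one_iff, hsgn t ht, sign_neg h])
        (mono_of _ _ _ fun t ht => by
          rw [derivative_neg, eval_neg, neg_pos, ← sign_eq_neg_one_iff, hsgnQ t ht, sign_neg h])
        (by simp only [eval_neg, sign_neg_congr]; exact haT)
        (by simp only [eval_neg, sign_neg_congr]; exact hbT)
      simpa only [eval_neg, sign_neg_congr, neg_eq_zero, ne_eq] using this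
    · exact gap_matching_of_strictMonoOn (p := fun t => P.eval t)
        (q := fun t => Q.eval t) Q.continuous φ hab P.continuous
        (mono_of _ _ _ fun t ht => by rw [← sign_eq_one_iff, hsgn t ht, sign_pos h])
        (mono_of _ _ _ fun t ht => by rw [← sign_eq_one_iff, hsgnQ t ht, sign_pos h]) haT hbT
  rcases main with h | ⟨c, hc, hPc, hQc, ψ, hψ, hψs⟩
  · exact (ht₀ (h t₀ ⟨hat, hbt⟩)).elim
  have hout : ∀ t, t ∉ Ioo a b → ψ (φ t) = φ t := by
    intro t ht
    apply hψ
    by_contra! hcon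
    exact ht ⟨by simpa using hcon.1, by simpa using hcon.2⟩
  have hTsub : T φ ⊆ T (φ.trans ψ) := by
    intro t ht
    by_cases htab : t ∈ Ioo a b
    · exact hψs t htab
    · show _ = SignType.sign (Q.eval (ψ (φ t)))
      rw [hout t htab]
      exact ht
  refine ih _ ?_ (φ.trans ψ) ?_ ?_ rfl
  · rw [← hN]
    apply Finset.card_lt_card
    rw [Finset.ssubset_iff_of_subset]
    · refine ⟨c, ?_, ?_⟩
      · rw [Finset.mem_filter, Multiset.mem_toFinset, mem_roots (by rintro rfl; simp at hd)]
        refine ⟨hPc, fun h => hQc ?_⟩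
        have h' : SignType.sign (P.eval c) = SignType.sign (Q.eval (φ c)) := h
        rw [hPc, sign_zero] at h'
        exact sign_eq_zero_iff.1 h'.symm
      · rw [Finset.mem_filter, not_and, not_not]
        exact fun _ => hψs c hc
    · intro t
      simp only [Finset.mem_filter]
      exact fun ⟨h1, h2⟩ => ⟨h1, fun h => h2 (hTsub h)⟩
  · intro w hw t
    show _ = SignType.sign (w.2.eval (ψ (φ t)))
    by_cases htab : t ∈ Ioo a b
    · by_cases hw0 : w.1 = 0
      · have := hφ w hw (φ.symm (ψ (φ t)))
        rw [φ.apply_symm_apply] at this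
        rw [← this, hw0, eval_zero, eval_zero]
      · have hmem : ψ (φ t) ∈ Ioo (φ a) (φ b) := by
          constructor
          · rw [← hψ (φ a) (Or.inl le_rfl)]; simpa using htab.1
          · rw [← hψ (φ b) (Or.inr le_rfl)]; simpa using htab.2
        have := hφ w hw (φ.symm (ψ (φ t)))
        rw [φ.apply_symm_apply] at this
        rw [← this]
        exact sign_eq_of_forall_ne_zero w.1.continuous (hgap w hw hw0) htab (hmid _ hmem)
    · rw [hout t htab]
      exact hφ w hw t
  · intro w hw hw0 t ht
    exact hTsub (hroot w hw hw0 t ht)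

section Tarski
open Polynomial

theorem exists_pseudoDivision {R : Type*} [CommRing R] (P Q : R[X]) (hQ : 0 < Q.natDegree) :
    ∃ (k : ℕ) (S T : R[X]), C Q.leadingCoeff ^ k * P = S * Q + T ∧
      T.natDegree < Q.natDegree := by
  induction hn : P.natDegree using Nat.strong_induction_on generalizing P with
  | _ n ih =>
  rcases lt_or_ge P.natDegree Q.natDegree with h | h
  · exact ⟨0, 0, P, by simp, h⟩
  · obtain ⟨k, S, T, h1, h2⟩ := ih _ (hn ▸ natDegree_cancelLeads_lt_of_natDegree_le_natDegree
      h (hQ.trans_le h)) (Q.cancelLeads P) rfl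
    refine ⟨k + 1, S + C Q.leadingCoeff ^ k * C P.leadingCoeff * X ^ (P.natDegree - Q.natDegree),
      T, ?_, h2⟩
    rw [cancelLeads, Nat.sub_eq_zero_of_le h] at h1
    linear_combination h1

theorem exists_evenPseudoRemainder {R : Type*} [CommRing R] (P Q : R[X])
    (hQ : 0 < Q.natDegree) :
    ∃ T : R[X], T.natDegree < Q.natDegree ∧ ∀ (x : R →+* ℝ) (t : ℝ), x Q.leadingCoeff ≠ 0 →
      (Q.map x).eval t = 0 →
      SignType.sign ((P.map x).eval t) = SignType.sign ((T.map x).eval t) := by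
  obtain ⟨k, S, T, h1, h2⟩ := exists_pseudoDivision P Q hQ
  refine ⟨C Q.leadingCoeff ^ k * T, ?_, fun x t hx ht => ?_⟩
  · rw [← C_pow]
    exact (natDegree_C_mul_le _ _).trans_lt h2
  · have h3 := congrArg (fun p => (p.map x).eval t) h1
    simp only [Polynomial.map_mul, Polynomial.map_add, Polynomial.map_pow, map_C, eval_mul,
      eval_add, eval_pow, eval_C, ht, mul_zero, zero_add] at h3
    simp only [Polynomial.map_mul, Polynomial.map_pow, map_C, eval_mul, eval_pow, eval_C,
      ← h3, ← mul_assoc, ← mul_pow]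
    rw [sign_mul, sign_pos (a := (x Q.leadingCoeff * x Q.leadingCoeff) ^ k), one_mul]
    exact pow_pos (mul_self_pos.2 hx) k

/-- Two real points of `R` give the same sign to every element of `𝒬`. -/
def SameSigns {R : Type*} [CommRing R] (𝒬 : Set R) (x y : R →+* ℝ) : Prop :=
  ∀ q ∈ 𝒬, SignType.sign (x q) = SignType.sign (y q)

theorem SameSigns.mono {R : Type*} [CommRing R] {𝒬 𝒬' : Set R} {x y : R →+* ℝ}
    (h : SameSigns 𝒬 x y) (hs : 𝒬' ⊆ 𝒬) : SameSigns 𝒬' x y := fun q hq => h q (hs hq)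

/-- The sign diagrams on the line of the specialisations of `Fs` at `x` and at `y` agree up to
an order isomorphism. -/
def SameDiagram {R : Type*} [CommRing R] (Fs : Multiset R[X]) (x y : R →+* ℝ) : Prop :=
  ∃ φ : ℝ ≃o ℝ, ∀ P ∈ Fs, ∀ t,
    SignType.sign ((P.map x).eval t) = SignType.sign ((P.map y).eval (φ t))

theorem exists_finite_sameDiagram_of_sameSigns {R : Type*} [CommRing R] [IsDomain R]
    [CharZero R] (s : Multiset ℕ) : ∀ Fs : Multiset R[X], Fs.map natDegree = s →
    ∃ 𝒬 : Set R, 𝒬.Finite ∧ ∀ x y : R →+* ℝ, SameSigns 𝒬 x y → SameDiagram Fs x y := by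
  classical
  induction s using (WellFounded.cutExpand (wellFounded_lt (α := ℕ))).induction with
  | _ s ih =>
  intro Fs hs
  by_cases hconst : ∀ P ∈ Fs, natDegree P = 0
  · refine ⟨(fun P : R[X] => P.coeff 0) '' {P | P ∈ Fs}, ?_, fun x y hxy =>
      ⟨OrderIso.refl ℝ, fun P hP t => ?_⟩⟩
    · exact Set.Finite.image _ (Multiset.finite_toSet Fs)
    · have := hxy _ (mem_image_of_mem _ (show P ∈ {P | P ∈ Fs} from hP))
      rw [eq_C_of_natDegree_eq_zero (hconst P hP)]
      simpa using this
  push Not at hconst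
  obtain ⟨P₁, hP₁, hP₁d⟩ := hconst
  obtain ⟨P, hP, hPmax⟩ := Set.exists_max_image {P | P ∈ Fs} natDegree
    (Multiset.finite_toSet Fs) ⟨P₁, hP₁⟩
  replace hPmax : ∀ Q ∈ Fs, Q.natDegree ≤ P.natDegree := hPmax
  have hPd : 0 < P.natDegree := (Nat.pos_of_ne_zero hP₁d).trans_le (hPmax P₁ hP₁)
  obtain ⟨Fs₀, rfl⟩ := Multiset.exists_cons_of_mem hP
  set Fs := P ::ₘ Fs₀ with hFs
  have hlead : ∀ Q : R[X], ∃ 𝒬 : Set R, 𝒬.Finite ∧ (Q ∈ Fs → 0 < Q.natDegree →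
      ∀ x y : R →+* ℝ, SameSigns 𝒬 x y → x Q.leadingCoeff = 0 → y Q.leadingCoeff = 0 →
      SameDiagram Fs x y) := by
    intro Q
    by_cases hQ : Q ∈ Fs ∧ 0 < Q.natDegree
    · obtain ⟨𝒬, h1, h2⟩ := ih ((Q.eraseLead ::ₘ Fs.erase Q).map natDegree) (by
        refine ⟨{Q.eraseLead.natDegree}, Q.natDegree, ?_, ?_⟩
        · intro a ha
          rw [Multiset.mem_singleton] at ha
          rw [ha]
          have := eraseLead_natDegree_le Q
          omega
        · rw [← hs, ← Multiset.cons_erase hQ.1]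
          simp only [Multiset.erase_cons_head, Multiset.map_cons]
          simp only [← Multiset.singleton_add]
          abel) _ rfl
      refine ⟨𝒬, h1, fun _ _ x y hxy hx hy => ?_⟩
      obtain ⟨φ, hφ⟩ := h2 x y hxy
      refine ⟨φ, fun F hF t => ?_⟩
      by_cases hFQ : F = Q
      · subst hFQ
        have he : ∀ z : R →+* ℝ, z F.leadingCoeff = 0 → F.map z = F.eraseLead.map z := by
          intro z hz
          conv_lhs => rw [← eraseLead_add_C_mul_X_pow F]
          rw [Polynomial.map_add, Polynomial.map_mul, map_C, hz, C_0, zero_mul, add_zero]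
        rw [he x hx, he y hy]
        exact hφ _ (Multiset.mem_cons_self _ _) t
      · exact hφ F (Multiset.mem_cons_of_mem ((Multiset.mem_erase_of_ne hFQ).2 hF)) t
    · exact ⟨∅, finite_empty, fun h1 h2 => (hQ ⟨h1, h2⟩).elim⟩
  choose 𝒬l h𝒬l h𝒬l' using hlead
  have hrem : ∀ Q : R[X], ∃ T : R[X], 0 < Q.natDegree → T.natDegree < Q.natDegree ∧
      ∀ (x : R →+* ℝ) (t : ℝ), x Q.leadingCoeff ≠ 0 → (Q.map x).eval t = 0 →
      SignType.sign ((P.map x).eval t) = SignType.sign ((T.map x).eval t) := by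
    intro Q
    by_cases hQ : 0 < Q.natDegree
    · obtain ⟨T, hT⟩ := exists_evenPseudoRemainder P Q hQ
      exact ⟨T, fun _ => hT⟩
    · exact ⟨0, fun h => (hQ h).elim⟩
  choose T hT using hrem
  have hdd : (derivative P).natDegree < P.natDegree := natDegree_derivative_lt hPd.ne'
  set Fs₁ : Multiset R[X] := derivative P ::ₘ Fs₀ with hFs₁
  set ℛ : Multiset R[X] := (Fs₁.filter fun Q => 0 < Q.natDegree).map T with hℛ
  obtain ⟨𝒬m, h𝒬m, h𝒬m'⟩ := ih ((Fs₁ + ℛ).map natDegree) (by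
    refine ⟨(derivative P ::ₘ ℛ).map natDegree, P.natDegree, ?_, ?_⟩
    · intro a ha
      rw [Multiset.mem_map] at ha
      obtain ⟨F, hF, rfl⟩ := ha
      rcases Multiset.mem_cons.1 hF with rfl | hF
      · exact hdd
      · rw [hℛ, Multiset.mem_map] at hF
        obtain ⟨Q, hQ, rfl⟩ := hF
        rw [Multiset.mem_filter] at hQ
        refine ((hT Q hQ.2).1).trans_le ?_
        rcases Multiset.mem_cons.1 hQ.1 with rfl | hQ'
        · exact hdd.le
        · exact hPmax Q (Multiset.mem_cons_of_mem hQ')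
    · rw [← hs, hFs₁, hFs]
      simp only [Multiset.map_add, Multiset.map_cons]
      simp only [← Multiset.singleton_add]
      abel) _ rfl
  refine ⟨leadingCoeff '' {Q | Q ∈ Fs} ∪ (⋃ Q ∈ {Q | Q ∈ Fs}, 𝒬l Q) ∪ 𝒬m, ?_, ?_⟩
  · exact (((Multiset.finite_toSet Fs).image _).union
      ((Multiset.finite_toSet Fs).biUnion fun Q _ => h𝒬l Q)).union h𝒬m
  intro x y hxy
  have hlc : ∀ Q ∈ Fs, SignType.sign (x Q.leadingCoeff) = SignType.sign (y Q.leadingCoeff) :=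
    fun Q hQ => hxy _ (Or.inl (Or.inl (mem_image_of_mem _ hQ)))
  by_cases hdeg : ∃ Q ∈ Fs, 0 < Q.natDegree ∧ x Q.leadingCoeff = 0
  · obtain ⟨Q, hQ, hQd, hx⟩ := hdeg
    refine h𝒬l' Q hQ hQd x y (hxy.mono ?_) hx ?_
    · exact (subset_biUnion_of_mem (u := 𝒬l) hQ).trans
        (subset_union_right.trans subset_union_left)
    · have := hlc Q hQ
      rw [hx, sign_zero] at this
      exact sign_eq_zero_iff.1 this.symm
  push Not at hdeg
  have hdegy : ∀ Q ∈ Fs, 0 < Q.natDegree → y Q.leadingCoeff ≠ 0 := by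
    intro Q hQ hQd h
    have := hlc Q hQ
    rw [h, sign_zero] at this
    exact hdeg Q hQ hQd (sign_eq_zero_iff.1 this)
  have hdlc : ∀ z : R →+* ℝ, z P.leadingCoeff ≠ 0 → z (derivative P).leadingCoeff ≠ 0 := by
    intro z hz
    rw [leadingCoeff, natDegree_derivative, coeff_derivative, Nat.sub_add_cancel hPd, map_mul]
    refine mul_ne_zero hz ?_
    have : ((P.natDegree - 1 : ℕ) : R) + 1 = ((P.natDegree : ℕ) : R) := by
      norm_cast
      omega
    rw [this, map_natCast]
    exact_mod_cast hPd.ne'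
  have hne : ∀ z : R →+* ℝ, (∀ Q ∈ Fs, 0 < Q.natDegree → z Q.leadingCoeff ≠ 0) →
      ∀ Q ∈ Fs₁, 0 < Q.natDegree → z Q.leadingCoeff ≠ 0 := by
    intro z hz Q hQ hQd
    rcases Multiset.mem_cons.1 hQ with rfl | hQ'
    · exact hdlc z (hz P (Multiset.mem_cons_self _ _) hPd)
    · exact hz Q (Multiset.mem_cons_of_mem hQ') hQd
  obtain ⟨φ, hφ⟩ := h𝒬m' x y (hxy.mono subset_union_right)
  have hPx := hdeg P (Multiset.mem_cons_self _ _) hPd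
  have hPy := hdegy P (Multiset.mem_cons_self _ _) hPd
  obtain ⟨φ', h1, h2⟩ := exists_matching_extension
    ((fun Q : R[X] => (Q.map x, Q.map y)) '' {Q | Q ∈ Fs₁})
    ((Multiset.finite_toSet Fs₁).image _) (P.map x) (P.map y)
    ⟨derivative P, Multiset.mem_cons_self _ _, by simp [derivative_map]⟩
    (by rwa [natDegree_map_of_leadingCoeff_ne_zero _ hPx])
    (by rw [natDegree_map_of_leadingCoeff_ne_zero _ hPx,
      natDegree_map_of_leadingCoeff_ne_zero _ hPy])
    (by
      rw [leadingCoeff_map_of_leadingCoeff_ne_zero _ hPx,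
        leadingCoeff_map_of_leadingCoeff_ne_zero _ hPy]
      exact hlc P (Multiset.mem_cons_self _ _))
    φ
    (by
      rintro _ ⟨Q, hQ, rfl⟩ t
      exact hφ Q (Multiset.mem_add.2 (Or.inl hQ)) t)
    (by
      rintro _ ⟨Q, hQ, rfl⟩ hQ0 t ht
      simp only at hQ0 ht
      by_cases hQd : 0 < Q.natDegree
      · have hTmem : T Q ∈ Fs₁ + ℛ := Multiset.mem_add.2 (Or.inr
          (Multiset.mem_map_of_mem T (Multiset.mem_filter.2 ⟨hQ, hQd⟩)))
        have hQy : (Q.map y).eval (φ t) = 0 := by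
          have := hφ Q (Multiset.mem_add.2 (Or.inl hQ)) t
          rw [ht, sign_zero] at this
          exact sign_eq_zero_iff.1 this.symm
        rw [(hT Q hQd).2 x t (hne x hdeg Q hQ hQd) ht,
          (hT Q hQd).2 y (φ t) (hne y hdegy Q hQ hQd) hQy]
        exact hφ _ hTmem t
      · rw [eq_C_of_natDegree_eq_zero (Nat.eq_zero_of_not_pos hQd)] at hQ0 ht
        simp at hQ0 ht
        exact (hQ0 ht).elim)
  refine ⟨φ', fun F hF t => ?_⟩
  rcases Multiset.mem_cons.1 hF with rfl | hF'
  · exact h2 t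
  · exact h1 _ ⟨F, Multiset.mem_cons_of_mem hF', rfl⟩ t

end Tarski

section SignDetermined
open MvPolynomial

/-- A predicate on `ℝ^σ` is sign determined if its truth value at a point depends only on the
signs of finitely many polynomials at that point. -/
def IsSignDetermined {σ : Type*} (p : (σ → ℝ) → Prop) : Prop :=
  ∃ 𝒬 : Set (MvPolynomial σ ℝ), 𝒬.Finite ∧
    ∀ x y, SameSigns 𝒬 (eval x) (eval y) → p x → p y

theorem SameSigns.symm {R : Type*} [CommRing R] {𝒬 : Set R} {x y : R →+* ℝ}
    (h : SameSigns 𝒬 x y) : SameSigns 𝒬 y x := fun q hq => (h q hq).symm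

namespace IsSignDetermined

variable {σ τ : Type*}

theorem not {p : (σ → ℝ) → Prop} (hp : IsSignDetermined p) :
    IsSignDetermined fun x => ¬ p x := by
  obtain ⟨𝒬, h1, h2⟩ := hp
  exact ⟨𝒬, h1, fun x y hxy hx hy => hx (h2 y x hxy.symm hy)⟩

theorem and {p q : (σ → ℝ) → Prop} (hp : IsSignDetermined p) (hq : IsSignDetermined q) :
    IsSignDetermined fun x => p x ∧ q x := by
  obtain ⟨𝒬, h1, h2⟩ := hp
  obtain ⟨𝒬', h1', h2'⟩ := hq
  exact ⟨𝒬 ∪ 𝒬', h1.union h1', fun x y hxy h => ⟨h2 x y (hxy.mono subset_union_left) h.1,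
    h2' x y (hxy.mono subset_union_right) h.2⟩⟩

theorem forall_finite {ι : Type*} [Finite ι] {p : ι → (σ → ℝ) → Prop}
    (hp : ∀ i, IsSignDetermined (p i)) : IsSignDetermined fun x => ∀ i, p i x := by
  choose 𝒬 h1 h2 using hp
  exact ⟨⋃ i, 𝒬 i, finite_iUnion h1, fun x y hxy h i =>
    h2 i x y (hxy.mono (subset_iUnion 𝒬 i)) (h i)⟩

theorem eval_eq_zero (q : MvPolynomial σ ℝ) : IsSignDetermined fun x => eval x q = 0 := by
  refine ⟨{q}, finite_singleton q, fun x y hxy hx => ?_⟩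
  have := hxy q rfl
  rw [hx, sign_zero] at this
  exact sign_eq_zero_iff.1 this.symm

theorem eval_pos (q : MvPolynomial σ ℝ) : IsSignDetermined fun x => 0 < eval x q := by
  refine ⟨{q}, finite_singleton q, fun x y hxy hx => ?_⟩
  have := hxy q rfl
  rw [sign_pos hx] at this
  exact sign_eq_one_iff.1 this.symm

theorem eval_nonneg (q : MvPolynomial σ ℝ) : IsSignDetermined fun x => 0 ≤ eval x q := by
  have := (eval_pos (-q)).not
  simpa using this

theorem comp {p : (σ → ℝ) → Prop} (hp : IsSignDetermined p) (f : σ → MvPolynomial τ ℝ) :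
    IsSignDetermined fun x => p fun i => eval x (f i) := by
  obtain ⟨𝒬, h1, h2⟩ := hp
  refine ⟨bind₁ f '' 𝒬, h1.image _, fun x y hxy hx => h2 _ _ (fun q hq => ?_) hx⟩
  have key : ∀ z : τ → ℝ, eval (fun i => eval z (f i)) q = eval z (bind₁ f q) := by
    intro z
    have := eval₂Hom_bind₁ (RingHom.id ℝ) z f q
    exact this.symm
  rw [key, key]
  exact hxy _ (mem_image_of_mem _ hq)

theorem exists_option {p : (Option σ → ℝ) → Prop} (hp : IsSignDetermined p) :
    IsSignDetermined fun x : σ → ℝ => ∃ t : ℝ, p fun o => o.elim t x := by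
  obtain ⟨𝒬, h1, h2⟩ := hp
  obtain ⟨𝒬', h1', h2'⟩ := exists_finite_sameDiagram_of_sameSigns (R := MvPolynomial σ ℝ) _
    (h1.toFinset.val.map (optionEquivLeft ℝ σ)) rfl
  refine ⟨𝒬', h1', ?_⟩
  rintro x y hxy ⟨t, ht⟩
  obtain ⟨φ, hφ⟩ := h2' _ _ hxy
  refine ⟨φ t, h2 _ _ (fun q hq => ?_) ht⟩
  have := hφ (optionEquivLeft ℝ σ q)
    (Multiset.mem_map_of_mem _ (by simpa using hq)) t
  rw [optionEquivLeft_elim_eval, optionEquivLeft_elim_eval]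
  exact this

theorem exists_sum [Finite τ] {p : (σ ⊕ τ → ℝ) → Prop} (hp : IsSignDetermined p) :
    IsSignDetermined fun x : σ → ℝ => ∃ y : τ → ℝ, p (Sum.elim x y) := by
  induction τ using Finite.induction_empty_option with
  | @of_equiv α β e ih =>
    have h1 : IsSignDetermined fun x : σ ⊕ α → ℝ => p (x ∘ Sum.map id e.symm) := by
      simpa [Function.comp_def] using hp.comp fun i => X (Sum.map id e.symm i)
    convert ih h1 using 2 with x
    constructor
    · rintro ⟨y, hy⟩
      refine ⟨y ∘ e, ?_⟩
      convert hy using 1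
      ext i
      rcases i with i | i <;> simp
    · rintro ⟨y, hy⟩
      refine ⟨y ∘ e.symm, ?_⟩
      convert hy using 1
      ext i
      rcases i with i | i <;> simp
  | h_empty =>
    have h1 : IsSignDetermined fun x : σ → ℝ => p (fun i => x (i.elim id PEmpty.elim)) := by
      simpa using hp.comp fun i => X (i.elim id PEmpty.elim)
    convert h1 using 2 with x
    constructor
    · rintro ⟨y, hy⟩
      convert hy using 1
      ext i
      rcases i with i | i
      · simp
      · exact i.elim
    · intro hy
      refine ⟨PEmpty.elim, ?_⟩
      convert hy using 1
      ext i
      rcases i with i | i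
      · simp
      · exact i.elim
  | @h_option α _ ih =>
    let f : σ ⊕ Option α → Option (σ ⊕ α) :=
      Sum.elim (fun i => some (Sum.inl i)) (fun o => o.map Sum.inr)
    have h1 : IsSignDetermined fun x : Option (σ ⊕ α) → ℝ => p (x ∘ f) := by
      simpa [Function.comp_def] using hp.comp fun i => X (f i)
    convert ih h1.exists_option using 2 with x
    constructor
    · rintro ⟨y, hy⟩
      refine ⟨y ∘ some, y none, ?_⟩
      convert hy using 1
      ext i
      rcases i with i | (_ | i) <;> simp [f]
    · rintro ⟨y, t, hy⟩
      refine ⟨fun o => o.elim t y, ?_⟩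
      convert hy using 1
      ext i
      rcases i with i | (_ | i) <;> simp [f]

theorem isSemialgebraic {n : ℕ} {p : (Fin n → ℝ) → Prop} (hp : IsSignDetermined p) :
    IsSemialgebraic n {x | p x} := by
  classical
  obtain ⟨𝒬, h1, h2⟩ := hp
  let V := {ν : h1.toFinset → SignType // ∃ x, p x ∧
    ∀ q : h1.toFinset, SignType.sign (eval x q.1) = ν q}
  let eV := Fintype.equivFin V
  let eQ := Fintype.equivFin h1.toFinset
  refine ⟨Fintype.card V, Fintype.card h1.toFinset,
    fun i j => if (eV.symm i).1 (eQ.symm j) = -1 then -(eQ.symm j).1 else (eQ.symm j).1,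
    fun i j => decide ((eV.symm i).1 (eQ.symm j) = 0), ?_⟩
  have key : ∀ (s : SignType) (q : MvPolynomial (Fin n) ℝ) (x : Fin n → ℝ),
      (if decide (s = 0) = true then eval x (if s = -1 then -q else q) = 0
        else 0 < eval x (if s = -1 then -q else q)) ↔ SignType.sign (eval x q) = s := by
    intro s q x
    cases s
    · simp [sign_eq_zero_iff]
    · simp [sign_eq_neg_one_iff]
    · simp [sign_eq_one_iff]
  ext x
  simp only [mem_ofPred_eq, mem_iUnion, mem_iInter, key]
  constructor
  · intro hx
    refine ⟨eV ⟨fun q => SignType.sign (eval x q.1), x, hx, fun _ => rfl⟩, fun j => ?_⟩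
    rw [Equiv.symm_apply_apply]
  · rintro ⟨i, hi⟩
    obtain ⟨y, hy, hyq⟩ := (eV.symm i).2
    refine h2 y x (fun q hq => ?_) hy
    have hq' : q ∈ h1.toFinset := by simpa using hq
    have := hi (eQ ⟨q, hq'⟩)
    rw [Equiv.symm_apply_apply] at this
    rw [this, ← hyq]

end IsSignDetermined
end SignDetermined

/-- An open convex cone `O` in a real vector space whose closure is pointed, with a linear
functional `e` that is positive on `O`. -/
structure PosCone (E : Type*) [NormedAddCommGroup E] [NormedSpace ℝ E] where
  /-- the open cone -/
  O : Set E
  /-- the positive functional -/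
  e : E →L[ℝ] ℝ
  isOpen : IsOpen O
  nonempty : O.Nonempty
  smul_mem : ∀ {t : ℝ} {x : E}, 0 < t → x ∈ O → t • x ∈ O
  add_mem : ∀ {x y : E}, x ∈ O → y ∈ O → x + y ∈ O
  e_pos : ∀ {x : E}, x ∈ O → 0 < e x
  pointed : ∀ {x : E}, x ∈ closure O → -x ∈ closure O → x = 0

namespace PosCone

variable {E : Type*} [NormedAddCommGroup E] [NormedSpace ℝ E] (S : PosCone E)

/-- The closed cone. -/
def D : Set E := closure S.O

theorem isClosed_D : IsClosed S.D := isClosed_closure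

theorem O_subset_D : S.O ⊆ S.D := subset_closure

theorem convex_O : Convex ℝ S.O := by
  intro x hx y hy a b ha hb hab
  rcases ha.eq_or_lt with rfl | ha
  · have : b = 1 := by linarith
    simpa [this] using hy
  rcases hb.eq_or_lt with rfl | hb
  · have : a = 1 := by linarith
    simpa [this] using hx
  exact S.add_mem (S.smul_mem ha hx) (S.smul_mem hb hy)

theorem convex_D : Convex ℝ S.D := S.convex_O.closure

theorem D_add {x y : E} (hx : x ∈ S.D) (hy : y ∈ S.D) : x + y ∈ S.D :=
  map_mem_closure₂ continuous_add hx hy fun _ h _ h' => S.add_mem h h'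

theorem D_smul_pos {t : ℝ} {x : E} (ht : 0 < t) (hx : x ∈ S.D) : t • x ∈ S.D :=
  map_mem_closure (continuous_const_smul t) hx fun _ h => S.smul_mem ht h

theorem zero_mem_D : (0 : E) ∈ S.D := by
  obtain ⟨x, hx⟩ := S.nonempty
  have h : Tendsto (fun t : ℝ => t • x) (𝓝[>] 0) (𝓝 ((0 : ℝ) • x)) :=
    ((continuous_id.smul continuous_const).tendsto 0).mono_left nhdsWithin_le_nhds
  rw [zero_smul] at h
  refine mem_closure_of_tendsto h ?_
  filter_upwards [self_mem_nhdsWithin] with t ht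
  exact S.smul_mem ht hx

theorem D_smul {t : ℝ} {x : E} (ht : 0 ≤ t) (hx : x ∈ S.D) : t • x ∈ S.D := by
  rcases ht.eq_or_lt with rfl | ht
  · rw [zero_smul]; exact S.zero_mem_D
  · exact S.D_smul_pos ht hx

theorem interior_D : interior S.D = S.O := by
  have h : (interior S.O).Nonempty := by rw [S.isOpen.interior_eq]; exact S.nonempty
  rw [D, S.convex_O.interior_closure_eq_interior_of_nonempty_interior h, S.isOpen.interior_eq]

theorem subset_O_of_isOpen {U : Set E} (hU : IsOpen U) (h : U ⊆ S.D) : U ⊆ S.O := by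
  rw [← S.interior_D]; exact interior_maximal h hU

theorem O_add_D {x d : E} (hx : x ∈ S.O) (hd : d ∈ S.D) : x + d ∈ S.O := by
  have h1 : IsOpen ((fun y => y + d) '' S.O) := (Homeomorph.addRight d).isOpenMap _ S.isOpen
  refine S.subset_O_of_isOpen h1 ?_ (mem_image_of_mem _ hx)
  rintro _ ⟨y, hy, rfl⟩
  exact S.D_add (S.O_subset_D hy) hd

theorem exists_dual_pos [FiniteDimensional ℝ E] :
    ∃ ψ : E →L[ℝ] ℝ, ∀ d ∈ S.D, ‖d‖ ≤ ψ d := by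
  have hK : IsCompact (S.D ∩ Metric.sphere 0 1) :=
    (isCompact_sphere (0 : E) 1).inter_left S.isClosed_D
  have h : ∃ f : E →L[ℝ] ℝ, (∀ d ∈ S.D, 0 ≤ f d) ∧ ∀ x ∈ S.D ∩ Metric.sphere 0 1, 0 < f x := by
    refine hK.induction_on
      (p := fun s => ∃ f : E →L[ℝ] ℝ, (∀ d ∈ S.D, 0 ≤ f d) ∧
        ∀ x ∈ S.D ∩ Metric.sphere 0 1 ∩ s, 0 < f x) ⟨0, by simp, by simp⟩ ?_ ?_ ?_ |>.imp ?_
    · rintro s t hst ⟨f, h1, h2⟩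
      exact ⟨f, h1, fun x hx => h2 x ⟨hx.1, hst hx.2⟩⟩
    · rintro s t ⟨f, h1, h2⟩ ⟨f', h1', h2'⟩
      refine ⟨f + f', fun d hd => add_nonneg (h1 d hd) (h1' d hd), ?_⟩
      rintro x ⟨hx, hxs | hxt⟩
      · exact add_pos_of_pos_of_nonneg (h2 x ⟨hx, hxs⟩) (h1' x hx.1)
      · exact add_pos_of_nonneg_of_pos (h1 x hx.1) (h2' x ⟨hx, hxt⟩)
    · intro x hx
      have hneg : -x ∉ S.D := by
        intro h
        have h0 := S.pointed hx.1 h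
        have := hx.2
        rw [h0] at this
        simp at this
      obtain ⟨f, u, hfu, hf⟩ := geometric_hahn_banach_point_closed S.convex_D S.isClosed_D hneg
      have hu : u < 0 := by simpa using hf 0 S.zero_mem_D
      have hfx : 0 < f x := by
        rw [map_neg] at hfu
        linarith
      refine ⟨{y | 0 < f y}, mem_nhdsWithin_of_mem_nhds
        ((isOpen_lt continuous_const f.continuous).mem_nhds hfx), f, ?_, fun y hy => hy.2⟩
      intro d hd
      by_contra! hneg
      have := hf _ (S.D_smul_pos (t := u / f d) (div_pos_of_neg_of_neg hu hneg) hd)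
      rw [map_smul, smul_eq_mul, div_mul_cancel₀ _ hneg.ne] at this
      exact lt_irrefl _ this
    · rintro f ⟨h1, h2⟩
      exact ⟨h1, fun x hx => h2 x ⟨hx, hx⟩⟩
  obtain ⟨f, hf, hf1⟩ := h
  have hm : ∃ m : ℝ, 0 < m ∧ ∀ x ∈ S.D ∩ Metric.sphere 0 1, m ≤ f x := by
    rcases (S.D ∩ Metric.sphere 0 1).eq_empty_or_nonempty with h0 | h0
    · exact ⟨1, one_pos, by simp [h0]⟩
    · obtain ⟨x, hx, hmin⟩ := hK.exists_isMinOn h0 f.continuous.continuousOn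
      exact ⟨f x, hf1 x hx, fun y hy => hmin hy⟩
  obtain ⟨m, hm0, hm⟩ := hm
  refine ⟨m⁻¹ • f, fun d hd => ?_⟩
  rcases eq_or_ne d 0 with rfl | hd0
  · simp
  have hd' : 0 < ‖d‖ := norm_pos_iff.2 hd0
  have h1 := hm (‖d‖⁻¹ • d) ⟨S.D_smul_pos (inv_pos.2 hd') hd, by
    simp [norm_smul, hd'.ne']⟩
  rw [map_smul, smul_eq_mul, le_inv_mul_iff₀ hd'] at h1
  rw [_root_.smul_apply, smul_eq_mul, le_inv_mul_iff₀ hm0]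
  linarith

theorem exists_opNorm_le [FiniteDimensional ℝ E] {K : Set E} (hK : IsCompact K)
    (hKO : K ⊆ S.O) :
    ∃ C : ℝ, 0 ≤ C ∧ ∀ g : E →L[ℝ] E, (∀ d ∈ S.D, g d ∈ S.D) → ∀ k ∈ K, ‖g‖ ≤ C * ‖g k‖ := by
  obtain ⟨δ, hδ, hsub⟩ := hK.exists_cthickening_subset_open S.isOpen hKO
  obtain ⟨ψ, hψ⟩ := S.exists_dual_pos
  refine ⟨‖ψ‖ / δ, by positivity, fun g hg k hk => ?_⟩
  have hmem : ∀ u : E, ‖u‖ ≤ δ → k + u ∈ S.D := by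
    intro u hu
    apply S.O_subset_D
    apply hsub
    apply Metric.mem_cthickening_of_dist_le _ k _ _ hk
    simpa using hu
  have h1 : ∀ u : E, ‖u‖ ≤ δ → ‖g u‖ ≤ ‖ψ‖ * ‖g k‖ := by
    intro u hu
    have e1 := hψ _ (hg _ (hmem u hu))
    have e2 := hψ _ (hg _ (hmem (-u) (by simpa using hu)))
    have e3 : ‖g (k + u) - g (k + -u)‖ ≤ ‖g (k + u)‖ + ‖g (k + -u)‖ := norm_sub_le _ _
    have e4 : g (k + u) - g (k + -u) = (2 : ℝ) • g u := by
      simp only [map_add, map_neg, two_smul]; abel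
    rw [e4, norm_smul, Real.norm_ofNat] at e3
    simp only [map_add, map_neg] at e1 e2 e3
    have e5 := (le_abs_self _).trans (ψ.le_opNorm (g k))
    linarith
  apply ContinuousLinearMap.opNorm_le_bound _ (by positivity)
  intro x
  rcases eq_or_ne x 0 with rfl | hx
  · simp
  have hx' : 0 < ‖x‖ := norm_pos_iff.2 hx
  have h2 := h1 ((δ / ‖x‖) • x) (by
    rw [norm_smul, Real.norm_of_nonneg (by positivity), div_mul_cancel₀ _ hx'.ne'])
  rw [map_smul, norm_smul, Real.norm_of_nonneg (by positivity), div_mul_eq_mul_div,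
    div_le_iff₀ hx'] at h2
  rw [div_mul_eq_mul_div, div_mul_eq_mul_div, le_div_iff₀ hδ]
  linarith

/-- The automorphisms of the cone that preserve the functional. -/
def Aut : Set (E →L[ℝ] E) := {g | IsUnit g ∧ S.e ∘L g = S.e ∧ g '' S.O = S.O}

variable {S}

theorem Aut.e_apply {g : E →L[ℝ] E} (hg : g ∈ S.Aut) (x : E) : S.e (g x) = S.e x := by
  conv_rhs => rw [← hg.2.1]
  rfl

theorem Aut.mem_O {g : E →L[ℝ] E} (hg : g ∈ S.Aut) {x : E} (hx : x ∈ S.O) : g x ∈ S.O := by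
  rw [← hg.2.2]; exact mem_image_of_mem _ hx

theorem Aut.mem_D {g : E →L[ℝ] E} (hg : g ∈ S.Aut) {x : E} (hx : x ∈ S.D) : g x ∈ S.D :=
  map_mem_closure g.continuous hx fun _ h => Aut.mem_O hg h

theorem Aut.one : (1 : E →L[ℝ] E) ∈ S.Aut :=
  ⟨isUnit_one, rfl, by simp⟩

theorem Aut.mul {g h : E →L[ℝ] E} (hg : g ∈ S.Aut) (hh : h ∈ S.Aut) : g * h ∈ S.Aut := by
  refine ⟨hg.1.mul hh.1, ?_, ?_⟩
  · ext x
    exact (Aut.e_apply hg _).trans (Aut.e_apply hh x)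
  · have : (g * h : E →L[ℝ] E) '' S.O = g '' (h '' S.O) := by rw [← image_comp]; rfl
    rw [this, hh.2.2, hg.2.2]

theorem Aut.mul_inv {g : E →L[ℝ] E} (hg : g ∈ S.Aut) : g * Ring.inverse g = 1 :=
  Ring.mul_inverse_cancel g hg.1

theorem Aut.inv_mul {g : E →L[ℝ] E} (hg : g ∈ S.Aut) : Ring.inverse g * g = 1 :=
  Ring.inverse_mul_cancel g hg.1

theorem Aut.inv_apply {g : E →L[ℝ] E} (hg : g ∈ S.Aut) (x : E) : Ring.inverse g (g x) = x :=
  DFunLike.congr_fun (Aut.inv_mul hg) x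

theorem Aut.apply_inv {g : E →L[ℝ] E} (hg : g ∈ S.Aut) (x : E) : g (Ring.inverse g x) = x :=
  DFunLike.congr_fun (Aut.mul_inv hg) x

theorem Aut.inv {g : E →L[ℝ] E} (hg : g ∈ S.Aut) : Ring.inverse g ∈ S.Aut := by
  refine ⟨hg.1.ringInverse, ?_, ?_⟩
  · ext x
    have := Aut.e_apply hg (Ring.inverse g x)
    rw [Aut.apply_inv hg] at this
    exact this.symm
  · conv_lhs => rw [← hg.2.2, ← image_comp]
    have : (Ring.inverse g : E →L[ℝ] E) ∘ g = id := funext (Aut.inv_apply hg)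
    rw [this, image_id]

theorem Aut.of_mul_eq_one {g h : E →L[ℝ] E} (hgh : g * h = 1) (hhg : h * g = 1)
    (he : ∀ x, S.e (g x) = S.e x) (hg : ∀ x ∈ S.D, g x ∈ S.D) (hh : ∀ x ∈ S.D, h x ∈ S.D) :
    g ∈ S.Aut := by
  have key : ∀ a b : E →L[ℝ] E, a * b = 1 → b * a = 1 → (∀ x ∈ S.D, a x ∈ S.D) →
      a '' S.O ⊆ S.O := by
    intro a b hab hba ha
    apply S.subset_O_of_isOpen
    · have : a '' S.O = b ⁻¹' S.O := by
        ext x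
        constructor
        · rintro ⟨y, hy, rfl⟩
          have : b (a y) = y := DFunLike.congr_fun hba y
          simpa [this] using hy
        · intro hx
          exact ⟨b x, hx, DFunLike.congr_fun hab x⟩
      rw [this]
      exact S.isOpen.preimage b.continuous
    · rintro _ ⟨y, hy, rfl⟩
      exact ha y (S.O_subset_D hy)
  refine ⟨⟨⟨g, h, hgh, hhg⟩, rfl⟩, by ext x; exact he x, (key g h hgh hhg hg).antisymm ?_⟩
  intro x hx
  exact ⟨h x, key h g hhg hgh hh (mem_image_of_mem _ hx), DFunLike.congr_fun hgh x⟩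

/-- The automorphism group is closed in the group of invertible maps. -/
theorem Aut.of_tendsto [CompleteSpace E] {ι : Type*} {l : Filter ι} [l.NeBot]
    {g : ι → E →L[ℝ] E} {a : E →L[ℝ] E} (hg : ∀ᶠ i in l, g i ∈ S.Aut)
    (ha : Tendsto g l (𝓝 a)) (hu : IsUnit a) : a ∈ S.Aut := by
  have happ : ∀ {f : ι → E →L[ℝ] E} {b : E →L[ℝ] E}, Tendsto f l (𝓝 b) →
      ∀ x, Tendsto (fun i => f i x) l (𝓝 (b x)) := fun hf x =>
    ((ContinuousLinearMap.apply ℝ E x).continuous.tendsto _).comp hf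
  obtain ⟨u, rfl⟩ := hu
  have hinv : Tendsto (fun i => Ring.inverse (g i)) l (𝓝 (Ring.inverse (u : E →L[ℝ] E))) :=
    (NormedRing.inverse_continuousAt u).tendsto.comp ha
  refine Aut.of_mul_eq_one (h := Ring.inverse (u : E →L[ℝ] E))
    (Ring.mul_inverse_cancel _ u.isUnit) (Ring.inverse_mul_cancel _ u.isUnit) ?_ ?_ ?_
  · intro x
    refine tendsto_nhds_unique ((S.e.continuous.tendsto _).comp (happ ha x)) ?_
    refine tendsto_const_nhds.congr' ?_
    filter_upwards [hg] with i hi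
    exact (Aut.e_apply hi x).symm
  · intro x hx
    refine S.isClosed_D.mem_of_tendsto (happ ha x) ?_
    filter_upwards [hg] with i hi
    exact Aut.mem_D hi hx
  · intro x hx
    refine S.isClosed_D.mem_of_tendsto (happ hinv x) ?_
    filter_upwards [hg] with i hi
    exact Aut.mem_D (Aut.inv hi) hx

end PosCone

theorem tendsto_clm_apply {E F ι : Type*} [NormedAddCommGroup E] [NormedSpace ℝ E]
    [NormedAddCommGroup F] [NormedSpace ℝ F] {l : Filter ι} {f : ι → E →L[ℝ] F}
    {b : E →L[ℝ] F} (hf : Tendsto f l (𝓝 b)) (x : E) :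
    Tendsto (fun i => f i x) l (𝓝 (b x)) :=
  ((ContinuousLinearMap.apply ℝ F x).continuous.tendsto _).comp hf

theorem tendsto_clm_apply₂ {E F ι : Type*} [NormedAddCommGroup E] [NormedSpace ℝ E]
    [NormedAddCommGroup F] [NormedSpace ℝ F] {l : Filter ι} {f : ι → E →L[ℝ] F}
    {b : E →L[ℝ] F} (hf : Tendsto f l (𝓝 b)) {x : ι → E} {y : E} (hx : Tendsto x l (𝓝 y)) :
    Tendsto (fun i => f i (x i)) l (𝓝 (b y)) :=
  (isBoundedBilinearMap_apply (𝕜 := ℝ) (E := E) (F := F)).continuous.tendsto (b, y) |>.comp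
    (hf.prodMk_nhds hx)

namespace PosCone

variable {E : Type*} [NormedAddCommGroup E] [NormedSpace ℝ E] [FiniteDimensional ℝ E]
  (S : PosCone E)

/-- `ζ` spans an extreme ray of the closed cone. -/
def IsExtremal (ζ : E) : Prop :=
  ζ ∈ S.D ∧ ζ ≠ 0 ∧ ∀ a ∈ S.D, ∀ b ∈ S.D, a + b = ζ → ∃ c : ℝ, a = c • ζ

theorem D_subset_of_isExtremal_mem {C : Set E} (hC : IsClosed C) (hconv : Convex ℝ C)
    (hsmul : ∀ t : ℝ, 0 < t → ∀ x ∈ C, t • x ∈ C) (h0 : (0 : E) ∈ C)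
    (hext : ∀ ζ, S.IsExtremal ζ → ζ ∈ C) : S.D ⊆ C := by
  obtain ⟨ψ, hψ⟩ := S.exists_dual_pos
  set B : Set E := S.D ∩ {x | ψ x = 1} with hB
  have hBc : IsCompact B := by
    apply Metric.isCompact_of_isClosed_isBounded
    · exact S.isClosed_D.inter (isClosed_eq ψ.continuous continuous_const)
    · refine Metric.isBounded_closedBall (x := (0 : E)) (r := 1) |>.subset ?_
      rintro x ⟨hx, hx1⟩
      have := hψ x hx
      rw [show ψ x = 1 from hx1] at this
      simpa using this
  have hBconv : Convex ℝ B := S.convex_D.inter (convex_hyperplane ψ.isLinear 1)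
  have hpos : ∀ d ∈ S.D, d ≠ 0 → 0 < ψ d := fun d hd h =>
    (norm_pos_iff.2 h).trans_le (hψ d hd)
  have hnorm : ∀ d ∈ S.D, d ≠ 0 → (ψ d)⁻¹ • d ∈ B := fun d hd h =>
    ⟨S.D_smul_pos (inv_pos.2 (hpos d hd h)) hd, by
      show ψ _ = 1
      rw [map_smul, smul_eq_mul, inv_mul_cancel₀ (hpos d hd h).ne']⟩
  have hextB : extremePoints ℝ B ⊆ C := by
    intro ζ hζ
    rw [mem_extremePoints] at hζ
    obtain ⟨hζB, hζe⟩ := hζ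
    have hψζ : ψ ζ = 1 := hζB.2
    refine hext ζ ⟨hζB.1, fun h => by rw [h, map_zero] at hψζ; exact zero_ne_one hψζ, ?_⟩
    intro a ha b hb hab
    by_cases ha0 : a = 0
    · exact ⟨0, by simp [ha0]⟩
    by_cases hb0 : b = 0
    · exact ⟨1, by simp [← hab, hb0]⟩
    have := hζe _ (hnorm a ha ha0) _ (hnorm b hb hb0) ⟨ψ a, ψ b, hpos a ha ha0, hpos b hb hb0,
      by rw [← map_add, hab, hψζ], by
        rw [smul_inv_smul₀ (hpos a ha ha0).ne', smul_inv_smul₀ (hpos b hb hb0).ne', hab]⟩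
    exact ⟨ψ a, by rw [← this.1, smul_inv_smul₀ (hpos a ha ha0).ne']⟩
  have hBC : B ⊆ C := by
    rw [← closure_convexHull_extremePoints hBc hBconv]
    exact closure_minimal (convexHull_min hextB hconv) hC
  intro d hd
  by_cases hd0 : d = 0
  · rwa [hd0]
  · have := hsmul _ (hpos d hd hd0) _ (hBC (hnorm d hd hd0))
    rwa [smul_inv_smul₀ (hpos d hd hd0).ne'] at this

theorem exists_isExtremal_e_pos : ∃ ζ, S.IsExtremal ζ ∧ 0 < S.e ζ := by
  by_contra! h
  have := S.D_subset_of_isExtremal_mem (C := {x | S.e x ≤ 0})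
    (isClosed_le S.e.continuous continuous_const) (convex_halfSpace_le S.e.isLinear 0)
    (fun t ht x hx => by
      show S.e _ ≤ 0
      rw [map_smul]
      exact mul_nonpos_of_nonneg_of_nonpos ht.le hx) (by simp) h
  obtain ⟨x, hx⟩ := S.nonempty
  exact absurd (S.e_pos hx) (not_lt.2 (this (S.O_subset_D hx)))

/-- The orbits of the automorphism group on the slice `e = 1` meet the compact set `K`. -/
structure IsCocompact (K : Set E) : Prop where
  isCompact : IsCompact K
  subset : K ⊆ S.O
  exists_mem : ∀ x ∈ S.O, S.e x = 1 → ∃ g ∈ S.Aut, g x ∈ K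

/-- No proper subspace meeting the slice `e = 1` is invariant. -/
def IsIrred : Prop :=
  ∀ F : Submodule ℝ E, (∀ g ∈ S.Aut, ∀ x ∈ F, g x ∈ F) → (∃ x ∈ F, S.e x = 1) → F = ⊤

variable {S}

theorem IsCocompact.exists_degeneration {K : Set E} (hK : S.IsCocompact K) {ζ : E}
    (hζ : S.IsExtremal ζ) :
    ∃ (H : E →L[ℝ] E) (c : ℕ → ℝ) (g : ℕ → E →L[ℝ] E), (∀ k, 0 < c k) ∧ (∀ k, g k ∈ S.Aut) ∧
      Tendsto (fun k => c k • g k) atTop (𝓝 H) ∧ (∀ x, ∃ t : ℝ, H x = t • ζ) ∧ H ≠ 0 := by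
  obtain ⟨hζD, hζ0, hζe⟩ := hζ
  obtain ⟨x, hxO, hx⟩ := mem_closure_iff_seq_limit.1 hζD
  have hex : ∀ k, 0 < S.e (x k) := fun k => S.e_pos (hxO k)
  have hg : ∀ k, ∃ g ∈ S.Aut, g ((S.e (x k))⁻¹ • x k) ∈ K := fun k =>
    hK.exists_mem _ (S.smul_mem (inv_pos.2 (hex k)) (hxO k)) (by
      rw [map_smul, smul_eq_mul, inv_mul_cancel₀ (hex k).ne'])
  choose g hgA hgK using hg
  obtain ⟨C, hC0, hC⟩ := S.exists_opNorm_le hK.isCompact hK.subset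
  set h : ℕ → E →L[ℝ] E := fun k => S.e (x k) • Ring.inverse (g k) with hh
  set y : ℕ → E := fun k => g k ((S.e (x k))⁻¹ • x k) with hy
  have hhy : ∀ k, h k (y k) = x k := by
    intro k
    simp only [hh, hy, _root_.smul_apply, Aut.inv_apply (hgA k),
      smul_inv_smul₀ (hex k).ne']
  have hhD : ∀ k, ∀ d ∈ S.D, h k d ∈ S.D := fun k d hd =>
    S.D_smul_pos (hex k) (Aut.mem_D (Aut.inv (hgA k)) hd)
  obtain ⟨R, hR⟩ := (Metric.isBounded_range_of_tendsto x hx).exists_norm_le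
  have hbound : ∀ k, (y k, h k) ∈ K ×ˢ Metric.closedBall (0 : E →L[ℝ] E) (C * R) := by
    intro k
    refine ⟨hgK k, ?_⟩
    rw [mem_closedBall_zero_iff]
    refine (hC (h k) (hhD k) _ (hgK k)).trans ?_
    rw [show h k (g k ((S.e (x k))⁻¹ • x k)) = x k from hhy k]
    exact mul_le_mul_of_nonneg_left (hR _ (mem_range_self k)) hC0
  obtain ⟨⟨y₀, H⟩, hmem, φ, hφ, hlim⟩ :=
    (hK.isCompact.prod (isCompact_closedBall (0 : E →L[ℝ] E) (C * R))).tendsto_subseq hbound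
  rw [nhds_prod_eq, tendsto_prod_iff'] at hlim
  have hlimH : Tendsto (fun k => h (φ k)) atTop (𝓝 H) := hlim.2
  have hlimy : Tendsto (fun k => y (φ k)) atTop (𝓝 y₀) := hlim.1
  have hHy : H y₀ = ζ := by
    refine tendsto_nhds_unique (tendsto_clm_apply₂ hlimH hlimy) ?_
    simp only [hhy]
    exact hx.comp hφ.tendsto_atTop
  have hHD : ∀ d ∈ S.D, H d ∈ S.D := fun d hd =>
    S.isClosed_D.mem_of_tendsto (tendsto_clm_apply hlimH d)
      (Eventually.of_forall fun k => hhD _ d hd)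
  refine ⟨H, fun k => S.e (x (φ k)), fun k => Ring.inverse (g (φ k)), fun k => hex _,
    fun k => Aut.inv (hgA _), hlimH, fun u => ?_, ?_⟩
  · have hy₀ : y₀ ∈ S.O := hK.subset hmem.1
    have hnhds : ∀ᶠ t : ℝ in 𝓝[>] 0, y₀ + t • u ∈ S.O ∧ y₀ - t • u ∈ S.O := by
      have h1 : Tendsto (fun t : ℝ => y₀ + t • u) (𝓝[>] 0) (𝓝 y₀) := by
        have : Continuous fun t : ℝ => y₀ + t • u := by fun_prop
        simpa using (this.tendsto 0).mono_left nhdsWithin_le_nhds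
      have h2 : Tendsto (fun t : ℝ => y₀ - t • u) (𝓝[>] 0) (𝓝 y₀) := by
        have : Continuous fun t : ℝ => y₀ - t • u := by fun_prop
        simpa using (this.tendsto 0).mono_left nhdsWithin_le_nhds
      exact (h1.eventually (S.isOpen.mem_nhds hy₀)).and (h2.eventually (S.isOpen.mem_nhds hy₀))
    obtain ⟨t, ⟨h1, h2⟩, ht⟩ := (hnhds.and self_mem_nhdsWithin).exists
    have ht0 : (0 : ℝ) < t := ht
    obtain ⟨c, hc⟩ := hζe ((2 : ℝ)⁻¹ • H (y₀ + t • u))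
      (S.D_smul_pos (by norm_num) (hHD _ (S.O_subset_D h1))) ((2 : ℝ)⁻¹ • H (y₀ - t • u))
      (S.D_smul_pos (by norm_num) (hHD _ (S.O_subset_D h2))) (by
        rw [← smul_add, ← map_add, ← hHy,
          show y₀ + t • u + (y₀ - t • u) = (2 : ℝ) • y₀ by rw [two_smul]; abel, map_smul,
          inv_smul_smul₀ two_ne_zero])
    refine ⟨t⁻¹ * (2 * c - 1), ?_⟩
    rw [map_add, map_smul, hHy, inv_smul_eq_iff₀ two_ne_zero] at hc
    rw [mul_smul, sub_smul, mul_smul, ← hc, one_smul, add_sub_cancel_left,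
      inv_smul_smul₀ ht0.ne']
  · rintro rfl
    exact hζ0 (by simpa using hHy.symm)

theorem IsCocompact.slice_subset_convexHull {K : Set E} (hK : S.IsCocompact K)
    (hirr : S.IsIrred) {T : Set E} (hT : T ⊆ S.D) (hT1 : ∀ x ∈ T, S.e x = 1)
    (hTne : T.Nonempty) (hinv : ∀ g ∈ S.Aut, ∀ x ∈ T, g x ∈ T) :
    ∀ x ∈ S.O, S.e x = 1 → x ∈ convexHull ℝ T := by
  have hspan : Submodule.span ℝ T = ⊤ := by
    apply hirr
    · intro g hg x hx
      have : Submodule.span ℝ T ≤ (Submodule.span ℝ T).comap (g : E →ₗ[ℝ] E) :=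
        Submodule.span_le.2 fun y hy => Submodule.subset_span (hinv g hg y hy)
      exact this hx
    · obtain ⟨x, hx⟩ := hTne
      exact ⟨x, Submodule.subset_span hx, hT1 x hx⟩
  set Q : ConvexCone ℝ E := ConvexCone.hull ℝ (convexHull ℝ T) with hQ
  have hQmem : ∀ {x}, x ∈ Q ↔ ∃ r : ℝ, 0 < r ∧ x ∈ r • convexHull ℝ T :=
    ConvexCone.mem_hull_of_convex (convex_convexHull ℝ T)
  have hTQ : ∀ x ∈ T, x ∈ Q := fun x hx =>
    ConvexCone.subset_hull (subset_convexHull ℝ T hx)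
  have hsm : ∀ t : ℝ, 0 < t → ∀ x ∈ closure (Q : Set E), t • x ∈ closure (Q : Set E) :=
    fun t ht x hx => map_mem_closure (continuous_const_smul t) hx fun _ h => Q.smul_mem ht h
  have hDQ : S.D ⊆ closure (Q : Set E) := by
    apply S.D_subset_of_isExtremal_mem isClosed_closure Q.convex.closure hsm
    · obtain ⟨x, hx⟩ := hTne
      have h : Tendsto (fun t : ℝ => t • x) (𝓝[>] 0) (𝓝 ((0 : ℝ) • x)) :=
        ((continuous_id.smul continuous_const).tendsto 0).mono_left nhdsWithin_le_nhds
      rw [zero_smul] at h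
      refine mem_closure_of_tendsto h ?_
      filter_upwards [self_mem_nhdsWithin] with t ht
      exact Q.smul_mem ht (hTQ x hx)
    · intro ζ hζ
      obtain ⟨H, c, g, hc, hg, hlim, hrange, hH0⟩ := hK.exists_degeneration hζ
      obtain ⟨x, hx, hx0⟩ : ∃ x ∈ T, H x ≠ 0 := by
        by_contra! hcon
        apply hH0
        have : Submodule.span ℝ T ≤ LinearMap.ker (H : E →ₗ[ℝ] E) :=
          Submodule.span_le.2 fun y hy => hcon y hy
        rw [hspan] at this
        ext y
        exact this (Submodule.mem_top (x := y))
      obtain ⟨t, ht⟩ := hrange x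
      have hHx : H x ∈ closure (Q : Set E) :=
        mem_closure_of_tendsto (tendsto_clm_apply hlim x) (Eventually.of_forall fun k =>
          Q.smul_mem (hc k) (hTQ _ (hinv _ (hg k) x hx)))
      have hHxD : H x ∈ S.D :=
        S.isClosed_D.mem_of_tendsto (tendsto_clm_apply hlim x) (Eventually.of_forall fun k =>
          S.D_smul_pos (hc k) (Aut.mem_D (hg k) (hT hx)))
      have ht0 : 0 < t := by
        by_contra! hneg
        rcases hneg.eq_or_lt with h | h
        · exact hx0 (by rw [ht, h, zero_smul])
        · apply hζ.2.1
          apply S.pointed hζ.1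
          have := S.D_smul_pos (t := -t⁻¹) (by rw [neg_pos]; exact inv_lt_zero.2 h) hHxD
          rwa [ht, smul_smul, neg_mul, inv_mul_cancel₀ h.ne, neg_one_smul] at this
      have := hsm _ (inv_pos.2 ht0) _ hHx
      rwa [ht, inv_smul_smul₀ ht0.ne'] at this
  have hint : (interior (Q : Set E)).Nonempty := by
    rw [Q.convex.interior_nonempty_iff_affineSpan_eq_top, eq_top_iff,
      ← S.isOpen.affineSpan_eq_top S.nonempty]
    refine affineSpan_le.2 (fun x hx => ?_)
    exact closure_minimal (subset_affineSpan ℝ (Q : Set E))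
      (AffineSubspace.closed_of_finiteDimensional _) (hDQ (S.O_subset_D hx))
  intro x hx hx1
  have hxQ : x ∈ Q := by
    have h1 : x ∈ interior (closure (Q : Set E)) :=
      interior_mono hDQ (by rw [S.interior_D]; exact hx)
    rw [Q.convex.interior_closure_eq_interior_of_nonempty_interior hint] at h1
    exact interior_subset h1
  obtain ⟨r, hr, z, hz, rfl⟩ := hQmem.1 hxQ
  have hz1 : S.e z = 1 :=
    convexHull_min hT1 (convex_hyperplane S.e.isLinear 1) hz
  have : r = 1 := by simpa [hz1] using hx1
  simpa [this] using hz

end PosCone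

theorem tendsto_norm_clm_sub {F : Type*} [NormedAddCommGroup F] [NormedSpace ℝ F]
    {a : ℕ → F →L[ℝ] F} {b : F →L[ℝ] F} (h : Tendsto a atTop (𝓝 b)) :
    Tendsto (fun k => ‖a k - b‖) atTop (𝓝 0) :=
  tendsto_iff_norm_sub_tendsto_zero.1 h

theorem tendsto_clm_pow {F : Type*} [NormedAddCommGroup F] [NormedSpace ℝ F]
    {a : ℕ → F →L[ℝ] F} {b : F →L[ℝ] F} (h : Tendsto a atTop (𝓝 b)) (m : ℕ) :
    Tendsto (fun k => a k ^ m) atTop (𝓝 (b ^ m)) :=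
  h.pow m

namespace PosCone

variable {E : Type*} [NormedAddCommGroup E] [NormedSpace ℝ E] [FiniteDimensional ℝ E]
  (S : PosCone E)

/-- The directions at infinity contain an order unit. -/
theorem exists_absorbing : ∃ v ∈ S.D, S.e v = 0 ∧
    ∀ c ∈ S.D, S.e c = 0 → ∃ μ : ℝ, 0 < μ ∧ v - μ • c ∈ S.D := by
  set C : Set E := {c | c ∈ S.D ∧ S.e c = 0} with hC
  obtain ⟨s, hsC, hs⟩ := (Submodule.fg_span_iff_fg_span_finset_subset C).1
    (IsNoetherian.noetherian (Submodule.span ℝ C))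
  have hsum : ∀ t : Finset E, ∀ a : E → ℝ, (∀ c ∈ t, c ∈ S.D ∧ 0 ≤ a c) →
      ∑ c ∈ t, a c • c ∈ S.D := by
    intro t a
    induction t using Finset.cons_induction with
    | empty => intro _; simpa using S.zero_mem_D
    | cons c t hc ih =>
      intro h
      rw [Finset.sum_cons]
      have h1 := h c (Finset.mem_cons_self c t)
      exact S.D_add (S.D_smul h1.2 h1.1) (ih fun x hx => h x (Finset.mem_cons.2 (Or.inr hx)))
  refine ⟨∑ c ∈ s, c, ?_, ?_, ?_⟩
  · simpa using hsum s (fun _ => 1) fun c hc => ⟨(hsC hc).1, zero_le_one⟩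
  · rw [map_sum]
    exact Finset.sum_eq_zero fun c hc => (hsC hc).2
  · intro c hcD hc0
    have hcs : c ∈ Submodule.span ℝ (s : Set E) := by
      rw [← hs]
      exact Submodule.subset_span ⟨hcD, hc0⟩
    obtain ⟨a, -, ha⟩ := Submodule.mem_span_finset.1 hcs
    set r : ℝ := 1 + ∑ x ∈ s, |a x| with hr
    have hr1 : 0 < r := by positivity
    refine ⟨r⁻¹, inv_pos.2 hr1, ?_⟩
    have h1 : ∑ x ∈ s, x - r⁻¹ • c = ∑ x ∈ s, (1 - r⁻¹ * a x) • x := by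
      rw [← ha, Finset.smul_sum, ← Finset.sum_sub_distrib]
      refine Finset.sum_congr rfl fun x _ => ?_
      rw [sub_smul, one_smul, mul_smul]
    rw [h1]
    refine hsum s _ fun x hx => ⟨(hsC hx).1, ?_⟩
    have h2 : |a x| ≤ ∑ y ∈ s, |a y| :=
      Finset.single_le_sum (f := fun y => |a y|) (fun y _ => abs_nonneg _) hx
    have h3 : a x ≤ r := (le_abs_self _).trans (by linarith)
    rw [sub_nonneg, inv_mul_le_iff₀ hr1, mul_one]
    exact h3

/-- The algebra generated by the automorphism group. -/
def alg : Subalgebra ℝ (E →L[ℝ] E) := Algebra.adjoin ℝ S.Aut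

variable {S}

theorem Aut.mem_alg {g : E →L[ℝ] E} (hg : g ∈ S.Aut) : g ∈ S.alg := Algebra.subset_adjoin hg

theorem isClosed_alg : IsClosed (S.alg : Set (E →L[ℝ] E)) :=
  S.alg.toSubmodule.closed_of_finiteDimensional

/-- Conjugation by `g`. -/
def conj (g : E →L[ℝ] E) : (E →L[ℝ] E) →L[ℝ] (E →L[ℝ] E) :=
  ContinuousLinearMap.mulLeftRight ℝ (E →L[ℝ] E) g (Ring.inverse g)

theorem conj_apply (g X : E →L[ℝ] E) : conj g X = g * X * Ring.inverse g := rfl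

theorem conj_mem_alg {g X : E →L[ℝ] E} (hg : g ∈ S.Aut) (hX : X ∈ S.alg) :
    conj g X ∈ S.alg :=
  S.alg.mul_mem (S.alg.mul_mem (Aut.mem_alg hg) hX) (Aut.mem_alg (Aut.inv hg))

theorem conj_mul {g : E →L[ℝ] E} (hg : g ∈ S.Aut) (X Y : E →L[ℝ] E) :
    conj g (X * Y) = conj g X * conj g Y := by
  have := Aut.inv_mul hg
  simp only [conj_apply]
  calc g * (X * Y) * Ring.inverse g = g * X * 1 * Y * Ring.inverse g := by noncomm_ring
    _ = _ := by rw [← this]; noncomm_ring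

theorem conj_one {g : E →L[ℝ] E} (hg : g ∈ S.Aut) : conj g 1 = 1 := by
  rw [conj_apply, mul_one, Aut.mul_inv hg]

theorem conj_mem_Aut {g h : E →L[ℝ] E} (hg : g ∈ S.Aut) (hh : h ∈ S.Aut) : conj g h ∈ S.Aut :=
  Aut.mul (Aut.mul hg hh) (Aut.inv hg)

/-- `Θ` is the limit on `S.alg` of the conjugations by automorphisms converging to `T`. -/
def IsAdLimit (S : PosCone E) (Θ : (E →L[ℝ] E) →L[ℝ] (E →L[ℝ] E)) (T : E →L[ℝ] E) : Prop :=
  ∃ (pr : (E →L[ℝ] E) →L[ℝ] (E →L[ℝ] E)) (g : ℕ → E →L[ℝ] E),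
    (∀ X, pr X ∈ S.alg) ∧ (∀ X ∈ S.alg, pr X = X) ∧ (∀ k, g k ∈ S.Aut) ∧
    Tendsto g atTop (𝓝 T) ∧ Tendsto (fun k => conj (g k) ∘L pr) atTop (𝓝 Θ)

theorem exists_proj (S : PosCone E) : ∃ pr : (E →L[ℝ] E) →L[ℝ] (E →L[ℝ] E),
    (∀ X, pr X ∈ S.alg) ∧ ∀ X ∈ S.alg, pr X = X := by
  obtain ⟨f, hf⟩ := Submodule.ClosedComplemented.of_finiteDimensional (𝕜 := ℝ)
    S.alg.toSubmodule
  exact ⟨S.alg.toSubmodule.subtypeL ∘L f, fun X => (f X).2, fun X hX =>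
    congrArg Subtype.val (hf ⟨X, hX⟩)⟩

namespace IsAdLimit

variable {Θ : (E →L[ℝ] E) →L[ℝ] (E →L[ℝ] E)} {T : E →L[ℝ] E}

theorem mem_alg (h : S.IsAdLimit Θ T) (X : E →L[ℝ] E) : Θ X ∈ S.alg := by
  obtain ⟨pr, g, h1, h2, hg, -, hlim⟩ := h
  exact isClosed_alg.mem_of_tendsto (tendsto_clm_apply hlim X)
    (Eventually.of_forall fun k => conj_mem_alg (hg k) (h1 X))

theorem exists_tendsto (h : S.IsAdLimit Θ T) : ∃ g : ℕ → E →L[ℝ] E, (∀ k, g k ∈ S.Aut) ∧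
    Tendsto g atTop (𝓝 T) ∧ ∀ X ∈ S.alg, Tendsto (fun k => conj (g k) X) atTop (𝓝 (Θ X)) := by
  obtain ⟨pr, g, h1, h2, hg, hT, hlim⟩ := h
  refine ⟨g, hg, hT, fun X hX => ?_⟩
  have := tendsto_clm_apply hlim X
  simpa [h2 X hX] using this

theorem exists_norm_conj_sub_lt (h : S.IsAdLimit Θ T) {δ : ℝ} (hδ : 0 < δ) :
    ∃ f ∈ S.Aut, ∀ X ∈ S.alg, ‖conj f X - Θ X‖ ≤ δ * ‖X‖ := by
  obtain ⟨pr, g, h1, h2, hg, hT, hlim⟩ := h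
  have : Tendsto (fun k => ‖conj (g k) ∘L pr - Θ‖) atTop (𝓝 0) :=
    tendsto_norm_clm_sub hlim
  obtain ⟨k, hk⟩ := (this.eventually (gt_mem_nhds hδ)).exists
  refine ⟨g k, hg k, fun X hX => ?_⟩
  have h3 : conj (g k) X - Θ X = (conj (g k) ∘L pr - Θ) X := by simp [h2 X hX]
  rw [h3]
  exact (ContinuousLinearMap.le_opNorm _ _).trans (by gcongr)

theorem map_one (h : S.IsAdLimit Θ T) : Θ 1 = 1 := by
  obtain ⟨g, hg, -, hlim⟩ := h.exists_tendsto
  refine tendsto_nhds_unique (hlim 1 S.alg.one_mem) ?_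
  simp only [conj_one (hg _)]
  exact tendsto_const_nhds

theorem map_mul (h : S.IsAdLimit Θ T) {X Y : E →L[ℝ] E} (hX : X ∈ S.alg) (hY : Y ∈ S.alg) :
    Θ (X * Y) = Θ X * Θ Y := by
  obtain ⟨g, hg, -, hlim⟩ := h.exists_tendsto
  refine tendsto_nhds_unique (hlim _ (S.alg.mul_mem hX hY)) ?_
  simp only [conj_mul (hg _)]
  exact (hlim X hX).mul (hlim Y hY)

theorem intertwine (h : S.IsAdLimit Θ T) {X : E →L[ℝ] E} (hX : X ∈ S.alg) :
    T * X = Θ X * T := by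
  obtain ⟨g, hg, hT, hlim⟩ := h.exists_tendsto
  refine tendsto_nhds_unique (hT.mul_const X) (((hlim X hX).mul hT).congr fun k => ?_)
  rw [conj_apply, mul_assoc, Aut.inv_mul (hg k), mul_one]

theorem e_apply (h : S.IsAdLimit Θ T) (x : E) : S.e (T x) = S.e x := by
  obtain ⟨g, hg, hT, -⟩ := h.exists_tendsto
  refine tendsto_nhds_unique ((S.e.continuous.tendsto _).comp (tendsto_clm_apply hT x)) ?_
  refine tendsto_const_nhds.congr fun k => ?_
  exact (Aut.e_apply (hg k) x).symm

theorem mem_D (h : S.IsAdLimit Θ T) {x : E} (hx : x ∈ S.D) : T x ∈ S.D := by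
  obtain ⟨g, hg, hT, -⟩ := h.exists_tendsto
  exact S.isClosed_D.mem_of_tendsto (tendsto_clm_apply hT x)
    (Eventually.of_forall fun k => Aut.mem_D (hg k) hx)

theorem mem_Aut (h : S.IsAdLimit Θ T) {γ : E →L[ℝ] E} (hγ : γ ∈ S.Aut) : Θ γ ∈ S.Aut := by
  have h1 : Θ γ * Θ (Ring.inverse γ) = 1 := by
    rw [← h.map_mul (Aut.mem_alg hγ) (Aut.mem_alg (Aut.inv hγ)), Aut.mul_inv hγ, h.map_one]
  have h2 : Θ (Ring.inverse γ) * Θ γ = 1 := by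
    rw [← h.map_mul (Aut.mem_alg (Aut.inv hγ)) (Aut.mem_alg hγ), Aut.inv_mul hγ, h.map_one]
  obtain ⟨g, hg, hT, hlim⟩ := h.exists_tendsto
  exact Aut.of_tendsto (Eventually.of_forall fun k => conj_mem_Aut (hg k) hγ)
    (hlim γ (Aut.mem_alg hγ)) ⟨⟨_, _, h1, h2⟩, rfl⟩

theorem isNilpotent (h : S.IsAdLimit Θ T) {X : E →L[ℝ] E} (hX : X ∈ S.alg) (h0 : Θ X = 0) :
    X ^ Module.finrank ℝ E = 0 := by
  obtain ⟨g, hg, hT, hlim⟩ := h.exists_tendsto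
  have hdet : ∀ t : ℝ, LinearMap.det
      (algebraMap ℝ (E →ₗ[ℝ] E) t - (X : E →ₗ[ℝ] E)) = t ^ Module.finrank ℝ E := by
    intro t
    have h1 : Tendsto (fun k => (t • (1 : E →L[ℝ] E) - conj (g k) X).det) atTop
        (𝓝 (t • (1 : E →L[ℝ] E) - Θ X).det) :=
      (ContinuousLinearMap.continuous_det.tendsto _).comp (tendsto_const_nhds.sub (hlim X hX))
    have h2 : ∀ k, (t • (1 : E →L[ℝ] E) - conj (g k) X).det =
        (t • (1 : E →L[ℝ] E) - X).det := by
      intro k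
      have h3 : t • (1 : E →L[ℝ] E) - conj (g k) X =
          g k * (t • (1 : E →L[ℝ] E) - X) * Ring.inverse (g k) := by
        rw [conj_apply, mul_sub, sub_mul, mul_smul_comm, mul_one, smul_mul_assoc,
          Aut.mul_inv (hg k)]
      have h4 : (g k).det * (Ring.inverse (g k)).det = 1 := by
        have := congrArg ContinuousLinearMap.det (Aut.mul_inv (hg k))
        simpa [ContinuousLinearMap.det] using this
      rw [h3]
      simp only [ContinuousLinearMap.det, ContinuousLinearMap.toLinearMap_mul,
        _root_.map_mul] at h4 ⊢
      rw [mul_right_comm, h4, one_mul]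
    simp only [h2] at h1
    have h5 := tendsto_nhds_unique h1 tendsto_const_nhds
    rw [h0, sub_zero] at h5
    have h6 : (t • (1 : E →L[ℝ] E)).det = t ^ Module.finrank ℝ E := by
      simp [ContinuousLinearMap.det]
    rw [h6] at h5
    rw [h5]
    rfl
  have hchar : (X : E →ₗ[ℝ] E).charpoly = Polynomial.X ^ Module.finrank ℝ E := by
    apply Polynomial.funext
    intro t
    rw [LinearMap.eval_charpoly, hdet]
    simp
  have := LinearMap.aeval_self_charpoly (X : E →ₗ[ℝ] E)
  rw [hchar] at this
  simp only [_root_.map_pow, Polynomial.aeval_X] at this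
  rw [← ContinuousLinearMap.toLinearMap_pow] at this
  exact ContinuousLinearMap.coe_injective this

theorem conj_conj {g h : E →L[ℝ] E} (hg : g ∈ S.Aut) (hh : h ∈ S.Aut) (X : E →L[ℝ] E) :
    conj g (conj h X) = conj (g * h) X := by
  have : Ring.inverse (g * h) = Ring.inverse h * Ring.inverse g := by
    obtain ⟨u, rfl⟩ := hg.1
    obtain ⟨v, rfl⟩ := hh.1
    rw [← Units.val_mul, Ring.inverse_unit, Ring.inverse_unit, Ring.inverse_unit,
      _root_.mul_inv_rev,
      Units.val_mul]
  simp only [conj_apply, this]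
  noncomm_ring

theorem pow (h : S.IsAdLimit Θ T) (m : ℕ) : S.IsAdLimit (Θ ^ (m + 1)) (T ^ (m + 1)) := by
  obtain ⟨pr, g, h1, h2, hg, hT, hlim⟩ := h
  have hgm : ∀ m k, g k ^ m ∈ S.Aut := by
    intro m k
    induction m with
    | zero => rw [pow_zero]; exact Aut.one
    | succ m ih => rw [pow_succ]; exact Aut.mul ih (hg k)
  refine ⟨pr, fun k => g k ^ (m + 1), h1, h2, fun k => hgm _ k, hT.pow _,
    (tendsto_clm_pow hlim (m + 1)).congr fun k => ?_⟩
  induction m with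
  | zero => simp
  | succ m ih =>
    rw [pow_succ' (conj (g k) ∘L pr), ih]
    ext1 X
    show conj (g k) (pr (conj (g k ^ (m + 1)) (pr X))) = _
    rw [h2 _ (conj_mem_alg (hgm _ k) (h1 X)), conj_conj (hg k) (hgm _ k), ← pow_succ']
    rfl

end IsAdLimit

end PosCone

theorem exists_tendsto_subseq_clm {F : Type*} [NormedAddCommGroup F] [NormedSpace ℝ F]
    [FiniteDimensional ℝ F] {a : ℕ → F →L[ℝ] F} {R : ℝ} (h : ∀ k, ‖a k‖ ≤ R) :
    ∃ (b : F →L[ℝ] F) (φ : ℕ → ℕ), StrictMono φ ∧ Tendsto (fun k => a (φ k)) atTop (𝓝 b) := by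
  obtain ⟨b, -, φ, hφ, hlim⟩ := tendsto_subseq_of_bounded
    (Metric.isBounded_closedBall (x := (0 : F →L[ℝ] F)) (r := R)) (x := a) fun k =>
      mem_closedBall_zero_iff.2 (h k)
  exact ⟨b, φ, hφ, hlim⟩

namespace PosCone

variable {E : Type*} [NormedAddCommGroup E] [NormedSpace ℝ E] [FiniteDimensional ℝ E]
  {S : PosCone E}

theorem exists_mem_slice (S : PosCone E) : ∃ x ∈ S.O, S.e x = 1 := by
  obtain ⟨x, hx⟩ := S.nonempty
  refine ⟨(S.e x)⁻¹ • x, S.smul_mem (inv_pos.2 (S.e_pos hx)) hx, ?_⟩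
  rw [map_smul, smul_eq_mul, inv_mul_cancel₀ (S.e_pos hx).ne']

theorem exists_smul_sub_mem {x : E} (hx : x ∈ S.O) (y : E) :
    ∃ R : ℝ, 0 < R ∧ ∀ r, R ≤ r → r • x - y ∈ S.D := by
  have h : Tendsto (fun t : ℝ => x - t • y) (𝓝[>] 0) (𝓝 x) := by
    have : Continuous fun t : ℝ => x - t • y := by fun_prop
    simpa using (this.tendsto 0).mono_left nhdsWithin_le_nhds
  obtain ⟨t, h1, ht⟩ := ((h.eventually (S.isOpen.mem_nhds hx)).and self_mem_nhdsWithin).exists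
  have ht0 : (0 : ℝ) < t := ht
  refine ⟨t⁻¹, inv_pos.2 ht0, fun r hr => ?_⟩
  have h2 : r • x - y = t⁻¹ • (x - t • y) + (r - t⁻¹) • x := by
    rw [smul_sub, inv_smul_smul₀ ht0.ne', sub_smul]; abel
  rw [h2]
  exact S.D_add (S.D_smul_pos (inv_pos.2 ht0) (S.O_subset_D h1))
    (S.D_smul (sub_nonneg.2 hr) (S.O_subset_D hx))

theorem tendsto_subseq_adLimit {f : ℕ → E →L[ℝ] E} (hf : ∀ k, f k ∈ S.Aut)
    (hb : ∃ R, ∀ k, ‖f k‖ ≤ R) (hconj : ∀ γ ∈ S.Aut, ∃ R, ∀ k, ‖conj (f k) γ‖ ≤ R) :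
    ∃ Θ T, S.IsAdLimit Θ T ∧ ∃ φ : ℕ → ℕ, StrictMono φ ∧
      Tendsto (fun k => f (φ k)) atTop (𝓝 T) := by
  obtain ⟨pr, hpr1, hpr2⟩ := exists_proj S
  have h1 : ∀ X ∈ S.alg, ∃ R, ∀ k, ‖conj (f k) X‖ ≤ R := by
    intro X hX
    induction hX using Algebra.adjoin_induction with
    | mem X hX => exact hconj X hX
    | algebraMap r =>
      refine ⟨‖r • (1 : E →L[ℝ] E)‖, fun k => ?_⟩
      rw [Algebra.algebraMap_eq_smul_one, map_smul, conj_one (hf k)]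
    | add X Y _ _ hX hY =>
      obtain ⟨R, hR⟩ := hX
      obtain ⟨R', hR'⟩ := hY
      exact ⟨R + R', fun k => by
        rw [map_add]; exact (norm_add_le _ _).trans (add_le_add (hR k) (hR' k))⟩
    | mul X Y _ _ hX hY =>
      obtain ⟨R, hR⟩ := hX
      obtain ⟨R', hR'⟩ := hY
      exact ⟨R * R', fun k => by
        rw [conj_mul (hf k)]
        exact (norm_mul_le _ _).trans (mul_le_mul (hR k) (hR' k) (norm_nonneg _)
          ((norm_nonneg _).trans (hR k)))⟩
  obtain ⟨C, hC⟩ := banach_steinhaus (g := fun k => conj (f k) ∘L pr)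
    fun X => h1 _ (hpr1 X)
  obtain ⟨R, hR⟩ := hb
  obtain ⟨Θ, φ, hφ, hΘ⟩ := exists_tendsto_subseq_clm hC
  obtain ⟨T, φ', hφ', hT⟩ := exists_tendsto_subseq_clm fun k => hR (φ k)
  exact ⟨Θ, T, ⟨pr, fun k => f (φ (φ' k)), hpr1, hpr2, fun k => hf _, hT,
    hΘ.comp hφ'.tendsto_atTop⟩, fun k => φ (φ' k), hφ.comp hφ', hT⟩

theorem IsCocompact.exists_adLimit {K : Set E} (hK : S.IsCocompact K) :
    ∃ Θ T, S.IsAdLimit Θ T ∧ ∀ c ∈ S.D, S.e c = 0 → T c = 0 := by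
  obtain ⟨v, hvD, hv0, hv⟩ := S.exists_absorbing
  obtain ⟨x₀, hx₀, hx₀1⟩ := S.exists_mem_slice
  obtain ⟨ψ, hψ⟩ := S.exists_dual_pos
  have hf : ∀ k : ℕ, ∃ f ∈ S.Aut, f (x₀ + (k : ℝ) • v) ∈ K := fun k =>
    hK.exists_mem _ (S.O_add_D hx₀ (S.D_smul (Nat.cast_nonneg k) hvD)) (by
      rw [map_add, map_smul, hv0, hx₀1, smul_zero, add_zero])
  choose f hfA hfK using hf
  obtain ⟨B, hB⟩ : ∃ B, ∀ k ∈ K, ψ k ≤ B := by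
    obtain ⟨B, hB⟩ := hK.isCompact.bddAbove_image ψ.continuous.continuousOn
    exact ⟨B, fun k hk => hB (mem_image_of_mem _ hk)⟩
  have hψ0 : ∀ d ∈ S.D, 0 ≤ ψ d := fun d hd => (norm_nonneg _).trans (hψ d hd)
  have hsplit : ∀ k : ℕ, ψ (f k x₀) + k * ψ (f k v) ≤ B := by
    intro k
    have := hB _ (hfK k)
    rwa [map_add, map_add, map_smul, map_smul, smul_eq_mul] at this
  have hf0 : ∀ k, 0 ≤ ψ (f k x₀) := fun k => hψ0 _ (Aut.mem_D (hfA k) (S.O_subset_D hx₀))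
  have hfv : ∀ k, 0 ≤ ψ (f k v) := fun k => hψ0 _ (Aut.mem_D (hfA k) hvD)
  obtain ⟨C₀, hC₀, hC₀'⟩ := S.exists_opNorm_le (isCompact_singleton (x := x₀))
    (singleton_subset_iff.2 hx₀)
  obtain ⟨C, hC, hC'⟩ := S.exists_opNorm_le hK.isCompact hK.subset
  have hbd : ∃ R, ∀ k, ‖f k‖ ≤ R := by
    refine ⟨C₀ * B, fun k => (hC₀' (f k) (fun d hd => Aut.mem_D (hfA k) hd) x₀ rfl).trans ?_⟩
    refine mul_le_mul_of_nonneg_left ((hψ _ (Aut.mem_D (hfA k) (S.O_subset_D hx₀))).trans ?_) hC₀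
    have := hsplit k
    have := mul_nonneg (Nat.cast_nonneg (α := ℝ) k) (hfv k)
    linarith
  have hconj : ∀ γ ∈ S.Aut, ∃ R, ∀ k, ‖conj (f k) γ‖ ≤ R := by
    intro γ hγ
    obtain ⟨R₁, hR₁, h1⟩ := exists_smul_sub_mem hx₀ (γ x₀)
    obtain ⟨μ, hμ, h2⟩ := hv (γ v) (Aut.mem_D hγ hvD) (by rw [Aut.e_apply hγ, hv0])
    set R := max R₁ μ⁻¹ with hR
    have h3 : R • v - γ v ∈ S.D := by
      have : R • v - γ v = μ⁻¹ • (v - μ • γ v) + (R - μ⁻¹) • v := by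
        rw [smul_sub, inv_smul_smul₀ hμ.ne', sub_smul]; abel
      rw [this]
      exact S.D_add (S.D_smul_pos (inv_pos.2 hμ) h2)
        (S.D_smul (sub_nonneg.2 (le_max_right _ _)) hvD)
    refine ⟨C * (R * B), fun k => ?_⟩
    set x := x₀ + (k : ℝ) • v with hx
    have hxD : x ∈ S.D := S.D_add (S.O_subset_D hx₀) (S.D_smul (Nat.cast_nonneg k) hvD)
    have h4 : R • x - γ x ∈ S.D := by
      have : R • x - γ x = (R • x₀ - γ x₀) + (k : ℝ) • (R • v - γ v) := by
        rw [hx, map_add, map_smul, smul_add, smul_sub, smul_comm R (k : ℝ) v]; abel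
      rw [this]
      exact S.D_add (h1 R (le_max_left _ _)) (S.D_smul (Nat.cast_nonneg k) h3)
    have h5 : conj (f k) γ (f k x) = f k (γ x) := by
      show f k (γ (Ring.inverse (f k) (f k x))) = _
      rw [Aut.inv_apply (hfA k)]
    have h6 := hψ0 _ (Aut.mem_D (hfA k) h4)
    rw [map_sub, map_sub, map_smul, map_smul, smul_eq_mul, sub_nonneg] at h6
    have hR0 : 0 ≤ R := hR₁.le.trans (le_max_left _ _)
    refine (hC' _ (fun d hd => Aut.mem_D (conj_mem_Aut (hfA k) hγ) hd) _ (hfK k)).trans ?_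
    rw [h5]
    refine mul_le_mul_of_nonneg_left ((hψ _ (Aut.mem_D (hfA k) (Aut.mem_D hγ hxD))).trans ?_) hC
    exact h6.trans (mul_le_mul_of_nonneg_left (hB _ (hfK k)) hR0)
  obtain ⟨Θ, T, h, φ, hφ, hlim⟩ := tendsto_subseq_adLimit hfA hbd hconj
  refine ⟨Θ, T, h, ?_⟩
  have hTv : T v = 0 := by
    have h1 : Tendsto (fun k => ψ (f (φ k) v)) atTop (𝓝 0) := by
      have h2 : Tendsto (fun k : ℕ => B / (φ k : ℝ)) atTop (𝓝 0) :=
        (tendsto_const_div_atTop_nhds_zero_nat B).comp hφ.tendsto_atTop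
      refine squeeze_zero' (Eventually.of_forall fun k => hfv _) ?_ h2
      filter_upwards [eventually_gt_atTop 0] with k hk
      have hk' : 0 < φ k := hk.trans_le hφ.le_apply
      rw [le_div_iff₀ (Nat.cast_pos.2 hk'), mul_comm]
      have := hsplit (φ k)
      have := hf0 (φ k)
      linarith
    have h3 : ψ (T v) = 0 :=
      tendsto_nhds_unique ((ψ.continuous.tendsto _).comp (tendsto_clm_apply hlim v)) h1
    have := hψ _ (h.mem_D hvD)
    rw [h3] at this
    exact norm_le_zero_iff.1 this
  intro c hc hc0
  obtain ⟨μ, hμ, h1⟩ := hv c hc hc0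
  have h2 := h.mem_D h1
  rw [map_sub, hTv, map_smul, zero_sub, ← smul_neg] at h2
  have h3 := S.D_smul_pos (inv_pos.2 hμ) h2
  rw [inv_smul_smul₀ hμ.ne'] at h3
  exact S.pointed (h.mem_D hc) h3

theorem IsCocompact.exists_adLimit_ker {K : Set E} (hK : S.IsCocompact K) :
    ∃ Θ T, S.IsAdLimit Θ T ∧ (∀ c ∈ S.D, S.e c = 0 → T c = 0) ∧
      (∀ X, Θ (Θ X) = 0 → Θ X = 0) ∧ ∀ x, T (T x) = 0 → T x = 0 := by
  obtain ⟨Θ, T, h, hT⟩ := hK.exists_adLimit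
  have key : ∀ {F : Type _} [NormedAddCommGroup F] [NormedSpace ℝ F] [FiniteDimensional ℝ F]
      (f : F →L[ℝ] F) (m : ℕ), Module.finrank ℝ F ≤ m →
      ∀ x, (f ^ m) ((f ^ m) x) = 0 → (f ^ m) x = 0 := by
    intro F _ _ _ f m hm x hx
    have h1 : x ∈ LinearMap.ker ((f : F →ₗ[ℝ] F) ^ (m + m)) := by
      rw [LinearMap.mem_ker, ← ContinuousLinearMap.toLinearMap_pow, pow_add]
      exact hx
    rw [Module.End.ker_pow_eq_ker_pow_finrank_of_le (hm.trans (Nat.le_add_right m m)),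
      ← Module.End.ker_pow_eq_ker_pow_finrank_of_le hm, LinearMap.mem_ker,
      ← ContinuousLinearMap.toLinearMap_pow] at h1
    exact h1
  set m := max (Module.finrank ℝ E) (Module.finrank ℝ (E →L[ℝ] E)) with hm
  refine ⟨_, _, h.pow m, ?_, key Θ _ ((le_max_right _ _).trans (Nat.le_succ m)),
    key T _ ((le_max_left _ _).trans (Nat.le_succ m))⟩
  intro c hc hc0
  rw [pow_succ]
  show (T ^ m) (T c) = 0
  rw [hT c hc hc0, map_zero]

theorem IsCocompact.exists_rankOne {K : Set E} (hK : S.IsCocompact K) :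
    ∃ (q : E) (g : ℕ → E →L[ℝ] E), (∀ k, g k ∈ S.Aut) ∧ q ∈ S.D ∧ S.e q = 1 ∧
      Tendsto g atTop (𝓝 (S.e.smulRight q)) := by
  obtain ⟨ζ, hζ, hζ0⟩ := S.exists_isExtremal_e_pos
  obtain ⟨H, c, g, hc, hg, hlim, hH, hH0⟩ := hK.exists_degeneration hζ
  choose t ht using hH
  obtain ⟨x₀, hx₀, hx₀1⟩ := S.exists_mem_slice
  have he : ∀ x, Tendsto (fun k => c k * S.e x) atTop (𝓝 (t x * S.e ζ)) := by
    intro x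
    have := (S.e.continuous.tendsto _).comp (tendsto_clm_apply hlim x)
    rw [ht, map_smul, smul_eq_mul] at this
    refine this.congr fun k => ?_
    show S.e (c k • g k x) = _
    rw [map_smul, Aut.e_apply (hg k), smul_eq_mul]
  set c₀ := t x₀ * S.e ζ with hc₀
  have hclim : Tendsto c atTop (𝓝 c₀) := by simpa [hx₀1] using he x₀
  have htx : ∀ x, t x * S.e ζ = c₀ * S.e x := fun x =>
    tendsto_nhds_unique (he x) (hclim.mul_const _)
  have hc0 : c₀ ≠ 0 := by
    intro h0
    apply hH0
    ext x
    have := htx x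
    rw [h0, zero_mul, mul_eq_zero, or_iff_left hζ0.ne'] at this
    rw [ht, this, zero_smul]
    rfl
  refine ⟨(S.e ζ)⁻¹ • ζ, g, hg, S.D_smul_pos (inv_pos.2 hζ0) hζ.1, ?_, ?_⟩
  · rw [map_smul, smul_eq_mul, inv_mul_cancel₀ hζ0.ne']
  · have h1 := (hclim.inv₀ hc0).smul hlim
    have h2 : c₀⁻¹ • H = S.e.smulRight ((S.e ζ)⁻¹ • ζ) := by
      ext x
      rw [ContinuousLinearMap.smulRight_apply, _root_.smul_apply, ht, smul_smul, smul_smul]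
      congr 1
      have := htx x
      field_simp
      linarith
    rw [← h2]
    refine h1.congr fun k => ?_
    rw [smul_smul, inv_mul_cancel₀ (hc k).ne', one_smul]

theorem IsCocompact.adLimit_eq_smulRight {K : Set E} (hK : S.IsCocompact K)
    {Θ : (E →L[ℝ] E) →L[ℝ] (E →L[ℝ] E)} {T : E →L[ℝ] E} (h : S.IsAdLimit Θ T)
    (hC : ∀ c ∈ S.D, S.e c = 0 → T c = 0) (hker : ∀ x, T (T x) = 0 → T x = 0) :
    ∃ p ∈ S.D, S.e p = 1 ∧ T = S.e.smulRight p ∧ ∀ γ ∈ S.Aut, Θ γ p = p := by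
  obtain ⟨q, g, hg, hq, hq1, hlim⟩ := hK.exists_rankOne
  have hbdd : Bornology.IsBounded {d | d ∈ S.D ∧ d ∈ T.range ∧ S.e d = 1} := by
    by_contra hcon
    have h1 : ∀ k : ℕ, ∃ d, (d ∈ S.D ∧ d ∈ T.range ∧ S.e d = 1) ∧ (k : ℝ) < ‖d‖ := by
      intro k
      by_contra! hk
      exact hcon (isBounded_iff_forall_norm_le.2 ⟨k, hk⟩)
    choose d hd hdk using h1
    have hpos : ∀ k, 0 < ‖d k‖ := fun k => (Nat.cast_nonneg k).trans_lt (hdk k)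
    obtain ⟨c, hc, φ, hφ, hclim⟩ := (isCompact_sphere (0 : E) 1).tendsto_subseq
      (x := fun k => ‖d k‖⁻¹ • d k) fun k => by
        rw [mem_sphere_zero_iff_norm, norm_smul, norm_inv, norm_norm,
          inv_mul_cancel₀ (hpos k).ne']
    have hcD : c ∈ S.D := S.isClosed_D.mem_of_tendsto hclim (Eventually.of_forall fun k =>
      S.D_smul_pos (inv_pos.2 (hpos _)) (hd _).1)
    have hcr : c ∈ T.range :=
      (T.range.closed_of_finiteDimensional).mem_of_tendsto hclim
        (Eventually.of_forall fun k => T.range.smul_mem _ (hd _).2.1)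
    have hce : S.e c = 0 := by
      refine tendsto_nhds_unique ((S.e.continuous.tendsto _).comp hclim) ?_
      have h2 : Tendsto (fun k => ‖d k‖⁻¹) atTop (𝓝 0) := by
        refine tendsto_inv_atTop_zero.comp ?_
        exact tendsto_atTop_mono (fun k => (hdk k).le) tendsto_natCast_atTop_atTop
      refine (h2.comp hφ.tendsto_atTop).congr fun k => ?_
      simp [(hd _).2.2]
    obtain ⟨x, rfl⟩ := hcr
    have h3 := hker x (hC _ hcD hce)
    have h4 : ‖T x‖ = 1 := by simpa using hc
    rw [h3, norm_zero] at h4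
    exact zero_ne_one h4
  obtain ⟨L, hL⟩ := (T : E →ₗ[ℝ] E).rangeRestrict.exists_rightInverse_of_surjective
    (LinearMap.range_rangeRestrict _)
  have hTL : ∀ y : (T : E →ₗ[ℝ] E).range, T (L y) = y := fun y =>
    congrArg Subtype.val (DFunLike.congr_fun hL y)
  have hslice : ∀ x ∈ S.D, S.e x = 1 → T x = T q := by
    intro x hx hx1
    set d : ℕ → (T : E →ₗ[ℝ] E).range := fun k => ⟨T (Ring.inverse (g k) x), ⟨_, rfl⟩⟩ with hd
    have hdb : ∃ R, ∀ k, ‖d k‖ ≤ R := by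
      obtain ⟨R, hR⟩ := hbdd.exists_norm_le
      have hmem : ∀ k, T (Ring.inverse (g k) x) ∈
          {d | d ∈ S.D ∧ d ∈ T.range ∧ S.e d = 1} := fun k =>
        ⟨h.mem_D (Aut.mem_D (Aut.inv (hg k)) hx), ⟨_, rfl⟩, by
          rw [h.e_apply, Aut.e_apply (Aut.inv (hg k)), hx1]⟩
      exact ⟨R, fun k => hR _ (hmem k)⟩
    obtain ⟨R, hR⟩ := hdb
    obtain ⟨d₀, -, φ, hφ, hdlim⟩ := tendsto_subseq_of_bounded
      (Metric.isBounded_closedBall (x := (0 : (T : E →ₗ[ℝ] E).range)) (r := R))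
      (x := d) fun k => mem_closedBall_zero_iff.2 (hR k)
    have hLlim : Tendsto (fun k => L (d (φ k))) atTop (𝓝 (L d₀)) :=
      (L.continuous_of_finiteDimensional.tendsto _).comp hdlim
    have h1 := (T.continuous.tendsto _).comp
      (tendsto_clm_apply₂ (hlim.comp hφ.tendsto_atTop) hLlim)
    have h2 : ∀ k, T (g k (L (d k))) = T x := by
      intro k
      have hint : ∀ y, T (g k y) = Θ (g k) (T y) := fun y =>
        DFunLike.congr_fun (h.intertwine (Aut.mem_alg (hg k))) y
      rw [hint, hTL]
      show Θ (g k) (T (Ring.inverse (g k) x)) = _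
      rw [← hint, Aut.apply_inv (hg k)]
    have h3 : T x = T (S.e (L d₀) • q) := by
      refine tendsto_nhds_unique ?_ h1
      exact tendsto_const_nhds.congr fun k => (h2 (φ k)).symm
    rw [map_smul] at h3
    have h4 := congrArg S.e h3
    rw [h.e_apply, hx1, map_smul, h.e_apply, hq1, smul_eq_mul, mul_one] at h4
    rw [h3, ← h4, one_smul]
  have hT : T = S.e.smulRight (T q) := by
    have h1 : (T : E →ₗ[ℝ] E).eqLocus ((S.e.smulRight (T q) : E →L[ℝ] E) : E →ₗ[ℝ] E) = ⊤ := by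
      apply Submodule.eq_top_of_nonempty_interior'
      refine S.nonempty.mono (interior_maximal (fun x hx => ?_) S.isOpen)
      show T x = S.e x • T q
      have hex := S.e_pos hx
      have h2 := hslice ((S.e x)⁻¹ • x) (S.D_smul_pos (inv_pos.2 hex) (S.O_subset_D hx)) (by
        rw [map_smul, smul_eq_mul, inv_mul_cancel₀ hex.ne'])
      rw [← h2, map_smul, smul_inv_smul₀ hex.ne']
    ext x
    have : x ∈ (T : E →ₗ[ℝ] E).eqLocus ((S.e.smulRight (T q) : E →L[ℝ] E) : E →ₗ[ℝ] E) := by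
      rw [h1]; trivial
    exact this
  refine ⟨T q, h.mem_D hq, by rw [h.e_apply, hq1], hT, fun γ hγ => ?_⟩
  have h1 : T (γ q) = Θ γ (T q) := DFunLike.congr_fun (h.intertwine (Aut.mem_alg hγ)) q
  rw [← h1, hslice _ (Aut.mem_D hγ hq) (by rw [Aut.e_apply hγ, hq1])]

end PosCone

section ExpLemmas

variable {𝔸 : Type*} [NormedRing 𝔸] [NormedAlgebra ℝ 𝔸] [CompleteSpace 𝔸]

theorem continuous_exp_real : Continuous (NormedSpace.exp : 𝔸 → 𝔸) := by
  let : NormedAlgebra ℚ 𝔸 := NormedAlgebra.restrictScalars ℚ ℝ 𝔸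
  exact NormedSpace.exp_continuous

theorem exp_add_smul (X : 𝔸) (s t : ℝ) : NormedSpace.exp ((s + t) • X) =
    NormedSpace.exp (s • X) * NormedSpace.exp (t • X) := by
  let : NormedAlgebra ℚ 𝔸 := NormedAlgebra.restrictScalars ℚ ℝ 𝔸
  rw [add_smul, NormedSpace.exp_add_of_commute (((Commute.refl X).smul_left s).smul_right t)]

theorem exp_mul_exp_neg (X : 𝔸) : NormedSpace.exp X * NormedSpace.exp (-X) = 1 := by
  have := exp_add_smul X 1 (-1)
  simpa using this.symm

theorem exp_neg_mul_exp (X : 𝔸) : NormedSpace.exp (-X) * NormedSpace.exp X = 1 := by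
  simpa using exp_mul_exp_neg (-X)

theorem exp_natCast_smul (X : 𝔸) (n : ℕ) :
    NormedSpace.exp ((n : ℝ) • X) = NormedSpace.exp X ^ n := by
  induction n with
  | zero => simp
  | succ n ih => rw [Nat.cast_succ, exp_add_smul, ih, one_smul, pow_succ]

theorem exists_exp_localInverse : ∃ L : 𝔸 → 𝔸, HasFDerivAt L (1 : 𝔸 →L[ℝ] 𝔸) 1 ∧ L 1 = 0 ∧
    (∀ᶠ y in 𝓝 (1 : 𝔸), NormedSpace.exp (L y) = y) ∧
    ∀ᶠ x in 𝓝 (0 : 𝔸), L (NormedSpace.exp x) = x := by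
  have h : HasStrictFDerivAt (NormedSpace.exp : 𝔸 → 𝔸)
      ((ContinuousLinearEquiv.refl ℝ 𝔸 : 𝔸 ≃L[ℝ] 𝔸) : 𝔸 →L[ℝ] 𝔸) 0 :=
    hasStrictFDerivAt_exp_zero
  have h1 := h.to_localInverse.hasFDerivAt
  have h2 := h.eventually_right_inverse
  have h3 := h.eventually_left_inverse
  rw [NormedSpace.exp_zero] at h1 h2
  refine ⟨_, h1, ?_, h2, h3⟩
  have := h3.self_of_nhds
  rwa [NormedSpace.exp_zero] at this

/-- A group of invertible elements that is closed among the invertible elements. -/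
structure IsClosedUnitGroup (G : Set 𝔸) : Prop where
  one_mem : (1 : 𝔸) ∈ G
  mul_mem : ∀ {g h : 𝔸}, g ∈ G → h ∈ G → g * h ∈ G
  exists_inv : ∀ {g : 𝔸}, g ∈ G → ∃ h ∈ G, g * h = 1 ∧ h * g = 1
  of_tendsto : ∀ {ι : Type} {l : Filter ι} [l.NeBot] {g : ι → 𝔸} {a : 𝔸},
    (∀ᶠ i in l, g i ∈ G) → Tendsto g l (𝓝 a) → IsUnit a → a ∈ G

namespace IsClosedUnitGroup

variable {G : Set 𝔸} (hG : IsClosedUnitGroup G)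

include hG

theorem exp_neg_mem {X : 𝔸} (h : NormedSpace.exp X ∈ G) : NormedSpace.exp (-X) ∈ G := by
  obtain ⟨k, hk, h1, -⟩ := hG.exists_inv h
  have : NormedSpace.exp (-X) = k := by
    calc NormedSpace.exp (-X) = NormedSpace.exp (-X) * (NormedSpace.exp X * k) := by
          rw [h1, mul_one]
      _ = k := by rw [← mul_assoc, exp_neg_mul_exp, one_mul]
  rwa [this]

theorem exp_intCast_smul_mem {X : 𝔸} (h : NormedSpace.exp X ∈ G) (n : ℤ) :
    NormedSpace.exp ((n : ℝ) • X) ∈ G := by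
  have key : ∀ Y : 𝔸, NormedSpace.exp Y ∈ G → ∀ m : ℕ, NormedSpace.exp ((m : ℝ) • Y) ∈ G := by
    intro Y hY m
    rw [exp_natCast_smul]
    induction m with
    | zero => rw [pow_zero]; exact hG.one_mem
    | succ m ih => rw [pow_succ]; exact hG.mul_mem ih hY
  obtain ⟨m, rfl | rfl⟩ := n.eq_nat_or_neg
  · simpa using key X h m
  · simpa using key (-X) (hG.exp_neg_mem h) m

theorem exp_mem_of_tendsto {ι : Type} {l : Filter ι} [l.NeBot] {X : ι → 𝔸} {r : ι → ℝ} {Z : 𝔸}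
    (hX : Tendsto X l (𝓝 0)) (hexp : ∀ᶠ i in l, NormedSpace.exp (X i) ∈ G)
    (hr : Tendsto (fun i => r i • X i) l (𝓝 Z)) : NormedSpace.exp Z ∈ G := by
  have h1 : Tendsto (fun i => Int.fract (r i) • X i) l (𝓝 0) := by
    refine squeeze_zero_norm (fun i => ?_) (tendsto_zero_iff_norm_tendsto_zero.1 hX)
    rw [norm_smul, Real.norm_of_nonneg (Int.fract_nonneg _)]
    exact mul_le_of_le_one_left (norm_nonneg _) (Int.fract_lt_one _).le
  have h2 : Tendsto (fun i => ((⌊r i⌋ : ℤ) : ℝ) • X i) l (𝓝 Z) := by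
    have := hr.sub h1
    rw [sub_zero] at this
    refine this.congr fun i => ?_
    rw [← sub_smul, Int.self_sub_fract]
  refine hG.of_tendsto (l := l) ?_ ((continuous_exp_real.tendsto _).comp h2)
    ⟨⟨_, _, exp_mul_exp_neg Z, exp_neg_mul_exp Z⟩, rfl⟩
  filter_upwards [hexp] with i hi
  exact hG.exp_intCast_smul_mem hi _

theorem exp_add_mem {X Y : 𝔸} (hX : ∀ t : ℝ, NormedSpace.exp (t • X) ∈ G)
    (hY : ∀ t : ℝ, NormedSpace.exp (t • Y) ∈ G) : NormedSpace.exp (X + Y) ∈ G := by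
  obtain ⟨L, hL, hL1, hright, -⟩ := exists_exp_localInverse (𝔸 := 𝔸)
  set c : ℝ → 𝔸 := fun s => NormedSpace.exp (s • X) * NormedSpace.exp (s • Y) with hc
  have hc0 : c 0 = 1 := by simp [hc]
  have hexp : ∀ Z : 𝔸, HasDerivAt (fun s : ℝ => NormedSpace.exp (s • Z)) Z 0 := by
    intro Z
    have := hasDerivAt_exp_smul_const (𝕂 := ℝ) Z (0 : ℝ)
    simpa using this
  have hcd : HasDerivAt c (X + Y) 0 := by
    have := (hexp X).mul (hexp Y)
    simp only [zero_smul, NormedSpace.exp_zero, mul_one, one_mul] at this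
    exact this
  have hd : HasDerivAt (fun s => L (c s)) (X + Y) 0 := by
    have hL' : HasFDerivAt L (1 : 𝔸 →L[ℝ] 𝔸) (c 0) := by rwa [hc0]
    exact hL'.comp_hasDerivAt 0 hcd
  have hslope := hd.tendsto_slope_zero
  simp only [zero_add, hc0, hL1, sub_zero] at hslope
  refine hG.exp_mem_of_tendsto (l := 𝓝[≠] (0 : ℝ)) ?_ ?_ hslope
  · have := hd.continuousAt.tendsto
    simp only [hc0, hL1] at this
    exact this.mono_left nhdsWithin_le_nhds
  · have h1 : Tendsto c (𝓝 0) (𝓝 1) := by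
      rw [← hc0]
      exact hcd.continuousAt.tendsto
    refine Filter.Eventually.filter_mono nhdsWithin_le_nhds ?_
    filter_upwards [h1.eventually hright] with s hs
    rw [hs]
    exact hG.mul_mem (hX s) (hY s)

/-- The Lie algebra. -/
def lie : Submodule ℝ 𝔸 where
  carrier := {X | ∀ t : ℝ, NormedSpace.exp (t • X) ∈ G}
  zero_mem' t := by
    rw [smul_zero, NormedSpace.exp_zero]
    exact hG.one_mem
  add_mem' {X Y} hX hY t := by
    rw [smul_add]
    exact hG.exp_add_mem (fun s => by rw [smul_smul]; exact hX _)
      fun s => by rw [smul_smul]; exact hY _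
  smul_mem' c X hX t := by
    rw [smul_smul]
    exact hX _

theorem exp_mem {X : 𝔸} (h : X ∈ hG.lie) : NormedSpace.exp X ∈ G := by
  simpa using h 1

theorem eventually_exists_exp_eq [FiniteDimensional ℝ 𝔸] {δ : ℝ} (hδ : 0 < δ) :
    ∀ᶠ a in 𝓝 (1 : 𝔸), a ∈ G → ∃ X ∈ hG.lie, ‖X‖ < δ ∧ NormedSpace.exp X = a := by
  obtain ⟨W, hW⟩ := Submodule.exists_isCompl hG.lie
  have hclaim : ∃ η : ℝ, 0 < η ∧ ∀ c ∈ W, ‖c‖ < η → NormedSpace.exp c ∈ G → c = 0 := by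
    by_contra! hcon
    have h1 : ∀ k : ℕ, ∃ c ∈ W, ‖c‖ < 1 / ((k : ℝ) + 1) ∧ NormedSpace.exp c ∈ G ∧ c ≠ 0 :=
      fun k => hcon _ Nat.one_div_pos_of_nat
    choose c hcW hck hcG hc0 using h1
    have hc : Tendsto c atTop (𝓝 0) :=
      squeeze_zero_norm (fun k => (hck k).le) tendsto_one_div_add_atTop_nhds_zero_nat
    have : ProperSpace 𝔸 := FiniteDimensional.proper ℝ 𝔸
    obtain ⟨a, ha, φ, hφ, hlim⟩ := (isCompact_sphere (0 : 𝔸) 1).tendsto_subseq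
      (x := fun k => ‖c k‖⁻¹ • c k) fun k => by
        rw [mem_sphere_zero_iff_norm, norm_smul, norm_inv, norm_norm,
          inv_mul_cancel₀ (norm_ne_zero_iff.2 (hc0 k))]
    have haW : a ∈ W := W.closed_of_finiteDimensional.mem_of_tendsto hlim
      (Eventually.of_forall fun k => W.smul_mem _ (hcW _))
    have hal : a ∈ hG.lie := by
      intro s
      refine hG.exp_mem_of_tendsto (l := atTop) (r := fun k => s * ‖c (φ k)‖⁻¹)
        (hc.comp hφ.tendsto_atTop) (Eventually.of_forall fun k => hcG _) ?_
      refine (hlim.const_smul s).congr fun k => ?_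
      simp [smul_smul]
    have h0 : a = 0 := Submodule.disjoint_def.1 hW.disjoint a hal haW
    rw [h0] at ha
    simp at ha
  obtain ⟨η, hη, hηc⟩ := hclaim
  set Φ : hG.lie × W → 𝔸 := fun p => NormedSpace.exp (p.1 : 𝔸) * NormedSpace.exp (p.2 : 𝔸)
    with hΦ
  set A₁ : hG.lie × W →L[ℝ] 𝔸 := hG.lie.subtypeL ∘L ContinuousLinearMap.fst ℝ _ _ with hA₁
  set A₂ : hG.lie × W →L[ℝ] 𝔸 := W.subtypeL ∘L ContinuousLinearMap.snd ℝ _ _ with hA₂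
  have hexp0 : HasStrictFDerivAt (NormedSpace.exp : 𝔸 → 𝔸) (1 : 𝔸 →L[ℝ] 𝔸) 0 :=
    hasStrictFDerivAt_exp_zero
  have hd1 : HasStrictFDerivAt (fun p : hG.lie × W => NormedSpace.exp (p.1 : 𝔸)) A₁ 0 := by
    have h : HasStrictFDerivAt (NormedSpace.exp : 𝔸 → 𝔸) (1 : 𝔸 →L[ℝ] 𝔸) (A₁ 0) := by
      rwa [map_zero]
    exact h.comp 0 A₁.hasStrictFDerivAt
  have hd2 : HasStrictFDerivAt (fun p : hG.lie × W => NormedSpace.exp (p.2 : 𝔸)) A₂ 0 := by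
    have h : HasStrictFDerivAt (NormedSpace.exp : 𝔸 → 𝔸) (1 : 𝔸 →L[ℝ] 𝔸) (A₂ 0) := by
      rwa [map_zero]
    exact h.comp 0 A₂.hasStrictFDerivAt
  have hd : HasStrictFDerivAt Φ (A₁ + A₂) 0 := by
    have := hd1.mul' hd2
    have h0 : NormedSpace.exp (((0 : hG.lie × W).1 : hG.lie) : 𝔸) = 1 := NormedSpace.exp_zero
    have h0' : NormedSpace.exp (((0 : hG.lie × W).2 : W) : 𝔸) = 1 := NormedSpace.exp_zero
    rw [h0, h0', one_smul, MulOpposite.op_one, one_smul, add_comm] at this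
    exact this
  have hsurj : ((A₁ + A₂ : hG.lie × W →L[ℝ] 𝔸) : hG.lie × W →ₗ[ℝ] 𝔸).range = ⊤ := by
    rw [eq_top_iff]
    intro x _
    obtain ⟨y, hy, z, hz, hyz⟩ := Submodule.mem_sup.1
      (hW.codisjoint.eq_top ▸ Submodule.mem_top : x ∈ hG.lie ⊔ W)
    exact ⟨(⟨y, hy⟩, ⟨z, hz⟩), hyz⟩
  have hmap := hd.map_nhds_eq_of_surj hsurj
  have hΦ0 : Φ 0 = 1 := by simp [hΦ]
  rw [hΦ0] at hmap
  have hnhds : {p : hG.lie × W | ‖(p.1 : 𝔸)‖ < δ ∧ ‖(p.2 : 𝔸)‖ < η} ∈ 𝓝 (0 : hG.lie × W) := by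
    refine IsOpen.mem_nhds ?_ (by simp [hδ, hη])
    exact (isOpen_lt A₁.continuous.norm continuous_const).inter
      (isOpen_lt A₂.continuous.norm continuous_const)
  have himg := image_mem_map (m := Φ) hnhds
  rw [hmap] at himg
  filter_upwards [himg]
  rintro _ ⟨⟨x, c⟩, ⟨hx, hc⟩, rfl⟩ hmem
  have h1 : NormedSpace.exp (c : 𝔸) ∈ G := by
    have h2 : NormedSpace.exp (c : 𝔸) =
        NormedSpace.exp (-(x : 𝔸)) * Φ (x, c) := by
      rw [hΦ, ← mul_assoc, exp_neg_mul_exp, one_mul]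
    rw [h2]
    exact hG.mul_mem (hG.exp_neg_mem (hG.exp_mem x.2)) hmem
  have h3 := hηc c c.2 hc h1
  exact ⟨x, x.2, hx, by simp [hΦ, h3]⟩

end IsClosedUnitGroup

end ExpLemmas

theorem map_exp_of_map_pow {𝔸 : Type*} [NormedRing 𝔸] [NormedAlgebra ℝ 𝔸] [CompleteSpace 𝔸]
    (φ : 𝔸 →L[ℝ] 𝔸) {X : 𝔸} (h : ∀ n : ℕ, φ (X ^ n) = φ X ^ n) :
    φ (NormedSpace.exp X) = NormedSpace.exp (φ X) := by
  have h1 := (NormedSpace.exp_series_hasSum_exp' (𝕂 := ℝ) X).mapL φ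
  simp only [map_smul, h] at h1
  exact h1.unique (NormedSpace.exp_series_hasSum_exp' (𝕂 := ℝ) (φ X))

namespace PosCone

variable {E : Type*} [NormedAddCommGroup E] [NormedSpace ℝ E] [FiniteDimensional ℝ E]
  {S : PosCone E}

theorem Aut.isClosedUnitGroup (S : PosCone E) : IsClosedUnitGroup S.Aut where
  one_mem := Aut.one
  mul_mem := Aut.mul
  exists_inv hg := ⟨_, Aut.inv hg, Aut.mul_inv hg, Aut.inv_mul hg⟩
  of_tendsto := Aut.of_tendsto

/-- The Lie algebra of the automorphism group. -/
def lieAlg (S : PosCone E) : Submodule ℝ (E →L[ℝ] E) := (Aut.isClosedUnitGroup S).lie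

theorem lieAlg_le_alg {X : E →L[ℝ] E} (hX : X ∈ S.lieAlg) : X ∈ S.alg := by
  have hd := hasDerivAt_exp_smul_const (𝕂 := ℝ) X (0 : ℝ)
  rw [zero_smul, NormedSpace.exp_zero, one_mul] at hd
  have h := hd.tendsto_slope_zero
  simp only [zero_add, zero_smul, NormedSpace.exp_zero] at h
  exact isClosed_alg.mem_of_tendsto h (Eventually.of_forall fun t =>
    S.alg.smul_mem (S.alg.sub_mem (Aut.mem_alg (hX t)) S.alg.one_mem) _)

theorem conj_exp {g : E →L[ℝ] E} (hg : g ∈ S.Aut) (X : E →L[ℝ] E) :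
    conj g (NormedSpace.exp X) = NormedSpace.exp (conj g X) := by
  refine map_exp_of_map_pow _ fun n => ?_
  induction n with
  | zero => rw [pow_zero, pow_zero, conj_one hg]
  | succ n ih => rw [pow_succ, conj_mul hg, ih, pow_succ]

theorem conj_mem_lieAlg {g X : E →L[ℝ] E} (hg : g ∈ S.Aut) (hX : X ∈ S.lieAlg) :
    conj g X ∈ S.lieAlg := by
  intro t
  rw [← map_smul, ← conj_exp hg]
  exact conj_mem_Aut hg (hX t)

theorem conj_inv_conj {g : E →L[ℝ] E} (hg : g ∈ S.Aut) (X : E →L[ℝ] E) :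
    conj (Ring.inverse g) (conj g X) = X := by
  rw [IsAdLimit.conj_conj (Aut.inv hg) hg, Aut.inv_mul hg, conj_apply, Ring.inverse_one,
    one_mul, mul_one]

namespace IsAdLimit

variable {Θ : (E →L[ℝ] E) →L[ℝ] (E →L[ℝ] E)} {T : E →L[ℝ] E}

theorem map_exp (h : S.IsAdLimit Θ T) {X : E →L[ℝ] E} (hX : X ∈ S.alg) :
    Θ (NormedSpace.exp X) = NormedSpace.exp (Θ X) := by
  refine map_exp_of_map_pow _ fun n => ?_
  induction n with
  | zero => rw [pow_zero, pow_zero, h.map_one]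
  | succ n ih => rw [pow_succ, h.map_mul (S.alg.pow_mem hX n) hX, ih, pow_succ]

theorem map_mem_lieAlg (h : S.IsAdLimit Θ T) {X : E →L[ℝ] E} (hX : X ∈ S.lieAlg) :
    Θ X ∈ S.lieAlg := by
  intro t
  rw [← map_smul, ← h.map_exp (S.alg.smul_mem (lieAlg_le_alg hX) t)]
  exact h.mem_Aut (hX t)

theorem map_conj (h : S.IsAdLimit Θ T) {g X : E →L[ℝ] E} (hg : g ∈ S.Aut) (hX : X ∈ S.alg) :
    Θ (conj g X) = Θ g * Θ X * Θ (Ring.inverse g) := by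
  rw [conj_apply, h.map_mul (S.alg.mul_mem (Aut.mem_alg hg) hX) (Aut.mem_alg (Aut.inv hg)),
    h.map_mul (Aut.mem_alg hg) hX]

theorem map_mul_map_inv (h : S.IsAdLimit Θ T) {g : E →L[ℝ] E} (hg : g ∈ S.Aut) :
    Θ g * Θ (Ring.inverse g) = 1 := by
  rw [← h.map_mul (Aut.mem_alg hg) (Aut.mem_alg (Aut.inv hg)), Aut.mul_inv hg, h.map_one]

theorem exists_map_map_eq (h : S.IsAdLimit Θ T) (hker : ∀ X, Θ (Θ X) = 0 → Θ X = 0)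
    {X : E →L[ℝ] E} (hX : X ∈ S.lieAlg) : ∃ Y ∈ S.lieAlg, Θ (Θ Y) = Θ X := by
  set W := S.lieAlg.map (Θ : (E →L[ℝ] E) →ₗ[ℝ] (E →L[ℝ] E)) with hW
  have hmaps : ∀ x ∈ W, (Θ : (E →L[ℝ] E) →ₗ[ℝ] (E →L[ℝ] E)) x ∈ W := by
    rintro _ ⟨Y, hY, rfl⟩
    exact ⟨Θ Y, h.map_mem_lieAlg hY, rfl⟩
  have hinj : Function.Injective ((Θ : (E →L[ℝ] E) →ₗ[ℝ] (E →L[ℝ] E)).restrict hmaps) := by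
    rw [← LinearMap.ker_eq_bot, LinearMap.ker_eq_bot']
    rintro ⟨_, ⟨Y, hY, rfl⟩⟩ h0
    exact Subtype.ext (hker Y (congrArg Subtype.val h0))
  obtain ⟨⟨_, ⟨Y, hY, rfl⟩⟩, hy⟩ := LinearMap.injective_iff_surjective.1 hinj ⟨Θ X, ⟨X, hX, rfl⟩⟩
  exact ⟨Y, hY, congrArg Subtype.val hy⟩

/-- The automorphisms in the kernel of the limit of conjugations. -/
def unip (S : PosCone E) (Θ : (E →L[ℝ] E) →L[ℝ] (E →L[ℝ] E)) : Set (E →L[ℝ] E) :=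
  {u | u ∈ S.Aut ∧ Θ u = 1}

theorem unip_mul (h : S.IsAdLimit Θ T) {u v : E →L[ℝ] E} (hu : u ∈ unip S Θ)
    (hv : v ∈ unip S Θ) : u * v ∈ unip S Θ :=
  ⟨Aut.mul hu.1 hv.1, by
    rw [h.map_mul (Aut.mem_alg hu.1) (Aut.mem_alg hv.1), hu.2, hv.2, one_mul]⟩

theorem unip_conj (h : S.IsAdLimit Θ T) {g u : E →L[ℝ] E} (hg : g ∈ S.Aut)
    (hu : u ∈ unip S Θ) : conj g u ∈ unip S Θ :=
  ⟨conj_mem_Aut hg hu.1, by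
    rw [h.map_conj hg (Aut.mem_alg hu.1), hu.2, mul_one, h.map_mul_map_inv hg]⟩

theorem exists_unip_apply_eq (h : S.IsAdLimit Θ T) (hker : ∀ X, Θ (Θ X) = 0 → Θ X = 0)
    {p : E} (hp : ∀ γ ∈ S.Aut, Θ γ p = p) {X : E →L[ℝ] E} (hX : X ∈ S.lieAlg) :
    ∃ u ∈ unip S Θ, NormedSpace.exp X p = u p := by
  obtain ⟨Y, hY, hYX⟩ := h.exists_map_map_eq hker hX
  have hb : -Θ Y ∈ S.lieAlg := S.lieAlg.neg_mem (h.map_mem_lieAlg hY)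
  have hG := Aut.isClosedUnitGroup S
  refine ⟨NormedSpace.exp X * NormedSpace.exp (-Θ Y),
    ⟨Aut.mul (hG.exp_mem hX) (hG.exp_mem hb), ?_⟩, ?_⟩
  · rw [h.map_mul (Aut.mem_alg (hG.exp_mem hX)) (Aut.mem_alg (hG.exp_mem hb)),
      h.map_exp (lieAlg_le_alg hX), h.map_exp (lieAlg_le_alg hb), map_neg, hYX,
      exp_mul_exp_neg]
  · have hY' : -Y ∈ S.lieAlg := S.lieAlg.neg_mem hY
    have h1 : NormedSpace.exp (-Θ Y) p = p := by
      rw [← map_neg, ← h.map_exp (lieAlg_le_alg hY')]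
      exact hp _ (hG.exp_mem hY')
    show _ = NormedSpace.exp X (NormedSpace.exp (-Θ Y) p)
    rw [h1]

/-- The Lie algebra of `unip S Θ`. -/
def nil (S : PosCone E) (Θ : (E →L[ℝ] E) →L[ℝ] (E →L[ℝ] E)) : Submodule ℝ (E →L[ℝ] E) :=
  S.lieAlg ⊓ (Θ : (E →L[ℝ] E) →ₗ[ℝ] (E →L[ℝ] E)).ker

theorem exp_mem_unip (h : S.IsAdLimit Θ T) {X : E →L[ℝ] E} (hX : X ∈ nil S Θ) :
    NormedSpace.exp X ∈ unip S Θ := by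
  refine ⟨(Aut.isClosedUnitGroup S).exp_mem hX.1, ?_⟩
  rw [h.map_exp (lieAlg_le_alg hX.1), show Θ X = 0 from hX.2, NormedSpace.exp_zero]

theorem exists_exp_eq (h : S.IsAdLimit Θ T) {u : E →L[ℝ] E} (hu : u ∈ unip S Θ) :
    ∃ X ∈ nil S Θ, NormedSpace.exp X = u := by
  have hG := Aut.isClosedUnitGroup S
  obtain ⟨L, -, hL1, -, hleft⟩ := exists_exp_localInverse (𝔸 := E →L[ℝ] E)
  obtain ⟨r, hr, hLr⟩ := Metric.eventually_nhds_iff.1 hleft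
  have hr' : 0 < r / (‖Θ‖ + 1) := by positivity
  obtain ⟨δ, hδ, hδG⟩ := Metric.eventually_nhds_iff.1 (hG.eventually_exists_exp_eq hr')
  obtain ⟨f, hf, hfΘ⟩ := h.exists_norm_conj_sub_lt (δ := δ / (‖u‖ + 1)) (by positivity)
  have h1 := hfΘ u (Aut.mem_alg hu.1)
  rw [hu.2] at h1
  have h2 : dist (conj f u) 1 < δ := by
    rw [dist_eq_norm]
    refine h1.trans_lt ?_
    rw [div_mul_eq_mul_div, div_lt_iff₀ (by positivity)]
    exact mul_lt_mul_of_pos_left (lt_add_one _) hδ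
  obtain ⟨X, hX, hXr, hXu⟩ := hδG h2 (conj_mem_Aut hf hu.1)
  have hΘX : Θ X = 0 := by
    have h3 : NormedSpace.exp (Θ X) = 1 := by
      rw [← h.map_exp (lieAlg_le_alg hX), hXu]
      exact (h.unip_conj hf hu).2
    have h4 : dist (Θ X) 0 < r := by
      rw [dist_zero_right]
      refine (Θ.le_opNorm X).trans_lt ?_
      rw [lt_div_iff₀ (by positivity)] at hXr
      nlinarith [norm_nonneg X, norm_nonneg Θ]
    have h5 := hLr h4
    rw [h3, hL1] at h5
    exact h5.symm
  refine ⟨conj (Ring.inverse f) X, ⟨conj_mem_lieAlg (Aut.inv hf) hX, ?_⟩, ?_⟩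
  · show Θ _ = 0
    rw [h.map_conj (Aut.inv hf) (lieAlg_le_alg hX), hΘX, mul_zero, zero_mul]
  · rw [← conj_exp (Aut.inv hf), hXu, conj_inv_conj hf]

end IsAdLimit

theorem isPreconnected_slice (S : PosCone E) : IsPreconnected (S.O ∩ {x | S.e x = 1}) :=
  (S.convex_O.inter (convex_hyperplane S.e.isLinear 1)).isPreconnected

/-- A subset of the automorphism group that is closed under products and contains all elements
moving some point of a neighbourhood `W` of `K` into `W` is the whole group. -/
theorem IsCocompact.subset_of_mul_mem {K : Set E} (hK : S.IsCocompact K) {W : Set E}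
    (hW : IsOpen W) (hKW : K ⊆ W) {H : Set (E →L[ℝ] E)}
    (hmul : ∀ g ∈ H, ∀ h ∈ H, g * h ∈ H) (hHA : H ⊆ S.Aut)
    (hH : ∀ g ∈ S.Aut, ∀ x ∈ W, g x ∈ W → g ∈ H) : S.Aut ⊆ H := by
  intro g₀ hg₀
  by_contra hcon
  set P := S.O ∩ {x | S.e x = 1} with hP
  have hopen : ∀ B : Set (E →L[ℝ] E), IsOpen (⋃ h ∈ B, (Ring.inverse h : E →L[ℝ] E) ⁻¹' W) :=
    fun B => isOpen_biUnion fun h _ => hW.preimage (Ring.inverse h : E →L[ℝ] E).continuous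
  obtain ⟨x₀, hx₀, hx₀1⟩ := S.exists_mem_slice
  obtain ⟨g₁, hg₁, hg₁K⟩ := hK.exists_mem x₀ hx₀ hx₀1
  set x₁ := g₁ x₀ with hx₁
  have hx₁P : x₁ ∈ P := ⟨Aut.mem_O hg₁ hx₀, by
    show S.e _ = 1
    rw [hx₁, Aut.e_apply hg₁, hx₀1]⟩
  have h1H : (1 : E →L[ℝ] E) ∈ H := hH 1 Aut.one x₁ (hKW hg₁K) (hKW hg₁K)
  obtain ⟨x, hx, hxA, hxB⟩ := S.isPreconnected_slice _ _ (hopen H) (hopen (S.Aut \ H)) (by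
    rintro x ⟨hxO, hx1⟩
    obtain ⟨g, hg, hgK⟩ := hK.exists_mem x hxO hx1
    have hgx : Ring.inverse (Ring.inverse g) x ∈ W := by
      have : Ring.inverse (Ring.inverse g) = g := by
        obtain ⟨u, rfl⟩ := hg.1
        rw [Ring.inverse_unit, Ring.inverse_unit, inv_inv]
      rw [this]
      exact hKW hgK
    by_cases hin : Ring.inverse g ∈ H
    · exact Or.inl (mem_biUnion hin hgx)
    · exact Or.inr (mem_biUnion (show Ring.inverse g ∈ S.Aut \ H from ⟨Aut.inv hg, hin⟩) hgx))
    ⟨x₁, hx₁P, mem_biUnion h1H (by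
      show (Ring.inverse (1 : E →L[ℝ] E)) x₁ ∈ W
      rw [Ring.inverse_one]
      exact hKW hg₁K)⟩
    ⟨g₀ x₁, ⟨Aut.mem_O hg₀ hx₁P.1, by
      show S.e _ = 1
      rw [Aut.e_apply hg₀]
      exact hx₁P.2⟩, mem_biUnion (show g₀ ∈ S.Aut \ H from ⟨hg₀, hcon⟩) (by
      show Ring.inverse g₀ (g₀ x₁) ∈ W
      rw [Aut.inv_apply hg₀]
      exact hKW hg₁K)⟩
  obtain ⟨h, hhH, hhx⟩ := mem_iUnion₂.1 hxA
  obtain ⟨g, ⟨hgA, hgH⟩, hgx⟩ := mem_iUnion₂.1 hxB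
  have hhA := hHA hhH
  apply hgH
  have h1 : Ring.inverse h * g ∈ H := by
    refine hH _ (Aut.mul (Aut.inv hhA) hgA) _ hgx ?_
    show Ring.inverse h (g (Ring.inverse g x)) ∈ W
    rw [Aut.apply_inv hgA]
    exact hhx
  have h2 := hmul _ hhH _ h1
  rwa [← mul_assoc, Aut.mul_inv hhA, one_mul] at h2

theorem IsCocompact.exists_orbit {K : Set E} (hK : S.IsCocompact K)
    {Θ : (E →L[ℝ] E) →L[ℝ] (E →L[ℝ] E)} {T : E →L[ℝ] E} (h : S.IsAdLimit Θ T)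
    (hker : ∀ X, Θ (Θ X) = 0 → Θ X = 0) {p : E} (hp : ∀ γ ∈ S.Aut, Θ γ p = p) :
    ∃ f ∈ S.Aut, ∀ γ ∈ S.Aut, ∃ u ∈ IsAdLimit.unip S Θ, γ (f p) = u (f p) := by
  obtain ⟨ε, hε, hεO⟩ := hK.isCompact.exists_cthickening_subset_open S.isOpen hK.subset
  have hK' : IsCompact (Metric.cthickening ε K) := hK.isCompact.cthickening
  obtain ⟨C, hC0, hC⟩ := S.exists_opNorm_le hK' hεO
  obtain ⟨B, hB⟩ := hK'.isBounded.exists_norm_le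
  have hWK : ∀ x ∈ Metric.thickening ε K, x ∈ Metric.cthickening ε K :=
    fun x hx => Metric.thickening_subset_cthickening ε K hx
  have hbound : ∀ g ∈ S.Aut, ∀ x ∈ Metric.thickening ε K, g x ∈ Metric.thickening ε K →
      ‖g‖ ≤ C * B := fun g hg x hx hgx =>
    (hC g (fun d hd => Aut.mem_D hg hd) x (hWK x hx)).trans
      (mul_le_mul_of_nonneg_left (hB _ (hWK _ hgx)) hC0)
  set R := max (C * B) 1 with hR
  have hR1 : 1 ≤ R := le_max_right _ _
  have hG := Aut.isClosedUnitGroup S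
  obtain ⟨δ, hδ, hδG⟩ := Metric.eventually_nhds_iff.1 (hG.eventually_exists_exp_eq one_pos)
  obtain ⟨f, hf, hfΘ⟩ := h.exists_norm_conj_sub_lt (δ := δ / (R * (‖Θ‖ * R) + 1))
    (by positivity)
  refine ⟨Ring.inverse f, Aut.inv hf, ?_⟩
  set q := Ring.inverse f p with hq
  have hfq : f q = p := Aut.apply_inv hf p
  suffices S.Aut ⊆ {γ | γ ∈ S.Aut ∧ ∃ u ∈ IsAdLimit.unip S Θ, γ q = u q} from
    fun γ hγ => (this hγ).2
  refine hK.subset_of_mul_mem (Metric.isOpen_thickening (δ := ε))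
    (Metric.self_subset_thickening hε K) ?_ (fun g hg => hg.1) ?_
  · rintro g ⟨hg, u, hu, hgu⟩ k ⟨hk, v, hv, hkv⟩
    refine ⟨Aut.mul hg hk, conj g v * u, h.unip_mul (h.unip_conj hg hv) hu, ?_⟩
    show g (k q) = g (v (Ring.inverse g (u q)))
    rw [hkv, ← hgu, Aut.inv_apply hg]
  · intro γ hγ x hx hγx
    refine ⟨hγ, ?_⟩
    have h1 : ‖γ‖ ≤ R := (hbound γ hγ x hx hγx).trans (le_max_left _ _)
    have h2 : ‖(Ring.inverse γ : E →L[ℝ] E)‖ ≤ R :=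
      (hbound _ (Aut.inv hγ) _ hγx (by rwa [Aut.inv_apply hγ])).trans (le_max_left _ _)
    set η := conj f γ * Θ (Ring.inverse γ) with hη
    have hηA : η ∈ S.Aut := Aut.mul (conj_mem_Aut hf hγ) (h.mem_Aut (Aut.inv hγ))
    have hdist : dist η 1 < δ := by
      have h3 : η - 1 = (conj f γ - Θ γ) * Θ (Ring.inverse γ) := by
        rw [sub_mul, h.map_mul_map_inv hγ]
      rw [dist_eq_norm, h3]
      calc ‖(conj f γ - Θ γ) * Θ (Ring.inverse γ)‖
          ≤ ‖conj f γ - Θ γ‖ * ‖Θ (Ring.inverse γ)‖ := norm_mul_le _ _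
        _ ≤ (δ / (R * (‖Θ‖ * R) + 1) * R) * (‖Θ‖ * R) := by
            refine mul_le_mul ((hfΘ γ (Aut.mem_alg hγ)).trans ?_)
              ((Θ.le_opNorm _).trans (by gcongr)) (norm_nonneg _) (by positivity)
            gcongr
        _ < δ := by
            rw [mul_assoc, div_mul_eq_mul_div, div_lt_iff₀ (by positivity)]
            exact mul_lt_mul_of_pos_left (lt_add_one _) hδ
    obtain ⟨X, hX, -, hXη⟩ := hδG hdist hηA
    obtain ⟨u, hu, hup⟩ := h.exists_unip_apply_eq hker hp hX
    refine ⟨conj (Ring.inverse f) u, h.unip_conj (Aut.inv hf) hu, ?_⟩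
    have h4 : conj f γ p = u p := by
      rw [← hup, hXη]
      show _ = conj f γ (Θ (Ring.inverse γ) p)
      rw [hp _ (Aut.inv hγ)]
    have h5 : f (γ q) = u p := h4
    have h6 : Ring.inverse (Ring.inverse f) = f := by
      obtain ⟨v, rfl⟩ := hf.1
      rw [Ring.inverse_unit, Ring.inverse_unit, inv_inv]
    show _ = Ring.inverse f (u (Ring.inverse (Ring.inverse f) q))
    rw [h6, hfq, ← h5, Aut.inv_apply hf]

/-- The slice `e = 1` of a cocompact irreducible cone is the convex hull of an orbit of a
nilpotent group, up to the boundary. -/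
theorem IsCocompact.exists_nilpotent {K : Set E} (hK : S.IsCocompact K) (hirr : S.IsIrred) :
    ∃ (N : Submodule ℝ (E →L[ℝ] E)) (p : E), (∀ X ∈ N, X ^ Module.finrank ℝ E = 0) ∧
      (∀ X ∈ N, NormedSpace.exp X p ∈ S.D ∧ S.e (NormedSpace.exp X p) = 1) ∧
      ∀ x ∈ S.O, S.e x = 1 → x ∈ convexHull ℝ {y | ∃ X ∈ N, NormedSpace.exp X p = y} := by
  obtain ⟨Θ, T, h, hC, hker, hTker⟩ := hK.exists_adLimit_ker
  obtain ⟨p, hpD, hp1, -, hp⟩ := hK.adLimit_eq_smulRight h hC hTker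
  obtain ⟨f, hf, horb⟩ := hK.exists_orbit h hker hp
  have hmem : ∀ X ∈ IsAdLimit.nil S Θ,
      NormedSpace.exp X (f p) ∈ S.D ∧ S.e (NormedSpace.exp X (f p)) = 1 := fun X hX =>
    ⟨Aut.mem_D (h.exp_mem_unip hX).1 (Aut.mem_D hf hpD), by
      rw [Aut.e_apply (h.exp_mem_unip hX).1, Aut.e_apply hf, hp1]⟩
  refine ⟨IsAdLimit.nil S Θ, f p, fun X hX => h.isNilpotent (lieAlg_le_alg hX.1) hX.2, hmem,
    hK.slice_subset_convexHull hirr ?_ ?_ ⟨_, 0, Submodule.zero_mem _, rfl⟩ ?_⟩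
  · rintro _ ⟨X, hX, rfl⟩
    exact (hmem X hX).1
  · rintro _ ⟨X, hX, rfl⟩
    exact (hmem X hX).2
  · rintro g hg _ ⟨X, hX, rfl⟩
    have hu := h.exp_mem_unip hX
    obtain ⟨v, hv, hgv⟩ := horb g hg
    obtain ⟨Y, hY, hYu⟩ := h.exists_exp_eq (h.unip_mul (h.unip_conj hg hu) hv)
    refine ⟨Y, hY, ?_⟩
    rw [hYu]
    show g (NormedSpace.exp X (Ring.inverse g (v (f p)))) = _
    rw [← hgv, Aut.inv_apply hg]

end PosCone

/-- A map into a vector space is polynomial if all its coordinates are. -/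
def IsPolynomialMap {σ E : Type*} [AddCommGroup E] [Module ℝ E] (y : (σ → ℝ) → E) : Prop :=
  ∀ l : E →ₗ[ℝ] ℝ, ∃ P : MvPolynomial σ ℝ, ∀ s, l (y s) = MvPolynomial.eval s P

theorem IsPolynomialMap.of_linearMap {n : ℕ} {E : Type*} [AddCommGroup E] [Module ℝ E]
    (f : (Fin n → ℝ) →ₗ[ℝ] E) (c : E) : IsPolynomialMap fun w => f w + c := by
  intro l
  refine ⟨∑ i, MvPolynomial.C (l (f (Pi.single i 1))) * MvPolynomial.X i + MvPolynomial.C (l c),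
    fun w => ?_⟩
  have h : f w = ∑ i, w i • f (Pi.single i 1) := by
    conv_lhs => rw [← Finset.univ_sum_single w]
    rw [map_sum]
    refine Finset.sum_congr rfl fun i _ => ?_
    rw [← map_smul, ← Pi.single_smul, smul_eq_mul, mul_one]
  simp [h, mul_comm]

theorem exists_fin_of_mem_convexHull {E : Type*} [AddCommGroup E] [Module ℝ E]
    [FiniteDimensional ℝ E] {α : Type*} [Nonempty α] {y : α → E} {x : E} :
    x ∈ convexHull ℝ (range y) ↔ ∃ (s : Fin (Module.finrank ℝ E + 1) → α)
      (t : Fin (Module.finrank ℝ E + 1) → ℝ), (∀ i, 0 ≤ t i) ∧ ∑ i, t i = 1 ∧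
        ∑ i, t i • y (s i) = x := by
  constructor
  · intro hx
    obtain ⟨ι, _, z, w, hz, hind, hw, hw1, hx⟩ := eq_pos_convex_span_of_mem_convexHull hx
    have hcard : Fintype.card ι ≤ Fintype.card (Fin (Module.finrank ℝ E + 1)) := by
      rw [Fintype.card_fin]
      exact hind.card_le_finrank_succ.trans
        (Nat.succ_le_succ (Submodule.finrank_le _))
    obtain ⟨e⟩ := Function.Embedding.nonempty_of_card_le hcard
    have hs : ∀ i, ∃ a, y a = z i := fun i => hz ⟨i, rfl⟩
    choose a ha using hs
    refine ⟨Function.extend e a fun _ => Classical.arbitrary α, Function.extend e w 0,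
      fun j => ?_, ?_, ?_⟩
    · by_cases hj : ∃ i, e i = j
      · obtain ⟨i, rfl⟩ := hj
        rw [e.injective.extend_apply]
        exact (hw i).le
      · rw [Function.extend_apply' _ _ _ hj, Pi.zero_apply]
    · rw [← hw1]
      refine (Fintype.sum_of_injective e e.injective _ _ (fun j hj => ?_) fun i => ?_).symm
      · rw [Function.extend_apply' _ _ _ hj, Pi.zero_apply]
      · rw [e.injective.extend_apply]
    · rw [← hx]
      refine (Fintype.sum_of_injective e e.injective _ _ (fun j hj => ?_) fun i => ?_).symm
      · rw [Function.extend_apply' _ _ _ hj, Pi.zero_apply, zero_smul]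
      · rw [e.injective.extend_apply, e.injective.extend_apply, ha]
  · rintro ⟨s, t, ht, ht1, rfl⟩
    exact (convex_convexHull ℝ _).sum_mem (fun i _ => ht i) ht1
      fun i _ => subset_convexHull ℝ _ ⟨_, rfl⟩

namespace IsSignDetermined

open MvPolynomial

theorem mem_convexHull {n d : ℕ} {E : Type*} [AddCommGroup E] [Module ℝ E]
    [FiniteDimensional ℝ E] {y : (Fin d → ℝ) → E} (hy : IsPolynomialMap y)
    {f : (Fin n → ℝ) → E} (hf : IsPolynomialMap f) :
    IsSignDetermined fun w => f w ∈ convexHull ℝ (range y) := by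
  set b := Module.finBasis ℝ E
  choose P hP using hy
  choose Q hQ using hf
  have key : IsSignDetermined fun z : Fin n ⊕ ((Fin (Module.finrank ℝ E + 1) × Fin d) ⊕
      Fin (Module.finrank ℝ E + 1)) → ℝ =>
      (∀ i, 0 ≤ eval z (X (.inr (.inr i)))) ∧ eval z (∑ i, X (.inr (.inr i)) - 1) = 0 ∧
      ∀ c, eval z (∑ i, X (.inr (.inr i)) *
        rename (fun j => .inr (.inl (i, j))) (P (b.coord c)) - rename .inl (Q (b.coord c))) = 0 :=
    (forall_finite fun _ => eval_nonneg _).and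
      ((eval_eq_zero _).and (forall_finite fun _ => eval_eq_zero _))
  convert key.exists_sum using 2 with w
  rw [exists_fin_of_mem_convexHull]
  simp only [map_sub, map_sum, map_mul, eval_X, map_one, eval_rename, sub_eq_zero, Sum.elim_inr]
  have hcoord : ∀ (s : Fin (Module.finrank ℝ E + 1) → Fin d → ℝ)
      (t : Fin (Module.finrank ℝ E + 1) → ℝ), ∑ i, t i • y (s i) = f w ↔
      ∀ c, ∑ i, t i * eval (s i) (P (b.coord c)) = eval w (Q (b.coord c)) := by
    intro s t
    rw [b.ext_elem_iff]
    refine forall_congr' fun c => ?_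
    simp only [← hP, ← hQ, map_sum, map_smul, Finsupp.coe_finsetSum, Finset.sum_apply,
      Finsupp.smul_apply, smul_eq_mul, Module.Basis.coord_apply]
  constructor
  · rintro ⟨s, t, h0, h1, h⟩
    exact ⟨Sum.elim (fun ij => s ij.1 ij.2) t, h0, h1, (hcoord s t).1 h⟩
  · rintro ⟨z, h0, h1, h⟩
    exact ⟨fun i j => z (.inl (i, j)), fun i => z (.inr i), h0, h1, (hcoord _ _).2 h⟩

theorem mem_interior {n : ℕ} {Z : Set (Fin n → ℝ)} (hZ : IsSignDetermined fun w => w ∈ Z) :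
    IsSignDetermined fun w => w ∈ interior Z := by
  have h0 : IsSignDetermined fun z : (Fin n ⊕ Unit) ⊕ Fin n → ℝ => (fun i => z (.inr i)) ∈ Z := by
    simpa only [eval_X] using
      hZ.comp fun i => (X (.inr i) : MvPolynomial ((Fin n ⊕ Unit) ⊕ Fin n) ℝ)
  have h1 : IsSignDetermined fun z : (Fin n ⊕ Unit) ⊕ Fin n → ℝ =>
      (∀ i, 0 < eval z (X (.inl (.inr ())) - (X (.inr i) - X (.inl (.inl i))))) ∧
      (∀ i, 0 < eval z (X (.inl (.inr ())) - (X (.inl (.inl i)) - X (.inr i)))) ∧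
      ¬ (fun i => z (.inr i)) ∈ Z :=
    (forall_finite fun _ => eval_pos _).and
      ((forall_finite fun _ => eval_pos _).and h0.not)
  have h2 := ((eval_pos (X (.inr ()) : MvPolynomial (Fin n ⊕ Unit) ℝ)).and
    h1.exists_sum.not).exists_sum
  convert h2 using 2 with w
  rw [mem_interior_iff_mem_nhds, Metric.mem_nhds_iff]
  simp only [eval_X, map_sub, Sum.elim_inr, Sum.elim_inl, not_exists, not_and, not_not]
  constructor
  · rintro ⟨ε, hε, h⟩
    refine ⟨fun _ => ε, hε, fun y hy1 hy2 => h ?_⟩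
    rw [Metric.mem_ball, dist_pi_lt_iff hε]
    intro i
    rw [Real.dist_eq, abs_lt]
    constructor <;> linarith [hy1 i, hy2 i]
  · rintro ⟨ε, hε, h⟩
    refine ⟨ε (), hε, fun y hy => ?_⟩
    rw [Metric.mem_ball, dist_pi_lt_iff hε] at hy
    refine h y (fun i => ?_) fun i => ?_ <;>
    · have := hy i
      rw [Real.dist_eq, abs_lt] at this
      linarith
end IsSignDetermined

theorem isPolynomialMap_sum_pow {d : ℕ} {E : Type*} [NormedAddCommGroup E] [NormedSpace ℝ E]
    (Y : Fin d → E →L[ℝ] E) (p : E) (k : ℕ) :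
    IsPolynomialMap fun s : Fin d → ℝ => ((∑ j, s j • Y j) ^ k) p := by
  induction k with
  | zero => exact fun l => ⟨MvPolynomial.C (l p), fun s => by simp⟩
  | succ k ih =>
    intro l
    choose P hP using fun j => ih (l ∘ₗ (Y j).toLinearMap)
    refine ⟨∑ j, MvPolynomial.X j * P j, fun s => ?_⟩
    simp [pow_succ', ← hP]

/-- The orbit of a vector under the exponentials of a space of nilpotent operators has a polynomial
parametrization. -/
theorem exists_isPolynomialMap_exp {E : Type*} [NormedAddCommGroup E] [NormedSpace ℝ E]
    [FiniteDimensional ℝ E] (N : Submodule ℝ (E →L[ℝ] E)) (p : E) {m : ℕ}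
    (hN : ∀ X ∈ N, X ^ m = 0) :
    ∃ (d : ℕ) (y : (Fin d → ℝ) → E), IsPolynomialMap y ∧
      range y = {y | ∃ X ∈ N, NormedSpace.exp X p = y} := by
  set b := Module.finBasis ℝ N
  have hexp : ∀ X ∈ N, NormedSpace.exp X p =
      ∑ k ∈ Finset.range m, (k.factorial : ℝ)⁻¹ • (X ^ k) p := by
    intro X hX
    have h1 := NormedSpace.exp_series_hasSum_exp' (𝕂 := ℝ) X
    have h2 : HasSum (fun k => (k.factorial : ℝ)⁻¹ • X ^ k)
        (∑ k ∈ Finset.range m, (k.factorial : ℝ)⁻¹ • X ^ k) := by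
      refine hasSum_sum_of_ne_finset_zero fun k hk => ?_
      rw [Finset.mem_range, not_lt] at hk
      rw [pow_eq_zero_of_le hk (hN X hX), smul_zero]
    rw [h1.unique h2]
    simp
  refine ⟨_, fun s => NormedSpace.exp (∑ j, s j • (b j : E →L[ℝ] E)) p, ?_, ?_⟩
  · intro l
    choose P hP using fun k => isPolynomialMap_sum_pow (fun j => (b j : E →L[ℝ] E)) p k l
    refine ⟨∑ k ∈ Finset.range m, MvPolynomial.C (k.factorial : ℝ)⁻¹ * P k, fun s => ?_⟩
    beta_reduce
    rw [hexp _ (N.sum_mem fun j _ => N.smul_mem _ (b j).2)]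
    simp [← hP]
  · ext y
    constructor
    · rintro ⟨s, rfl⟩
      exact ⟨_, N.sum_mem fun j _ => N.smul_mem _ (b j).2, rfl⟩
    · rintro ⟨X, hX, rfl⟩
      refine ⟨fun j => b.repr ⟨X, hX⟩ j, ?_⟩
      have := congrArg N.subtype (b.sum_repr ⟨X, hX⟩)
      simp only [map_sum, map_smul, Submodule.subtype_apply] at this
      simp only [this]

section ConeOver

variable {V : Type*} [NormedAddCommGroup V] [NormedSpace ℝ V]

/-- The cone over a subset of a vector space. -/
def coneOver (Ω : Set V) : Set (V × ℝ) := {z | 0 < z.2 ∧ z.2⁻¹ • z.1 ∈ Ω}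

variable {Ω : Set V}

theorem mem_coneOver_one {x : V} : (x, (1 : ℝ)) ∈ coneOver Ω ↔ x ∈ Ω := by
  simp [coneOver]

theorem coneOver_smul_mem {t : ℝ} {z : V × ℝ} (ht : 0 < t) (hz : z ∈ coneOver Ω) :
    t • z ∈ coneOver Ω := by
  refine ⟨mul_pos ht hz.1, ?_⟩
  convert hz.2 using 1
  simp only [Prod.smul_snd, Prod.smul_fst, smul_eq_mul, smul_smul]
  congr 1
  field_simp

theorem Convex.coneOver_add_mem (hΩ : Convex ℝ Ω) {z w : V × ℝ} (hz : z ∈ coneOver Ω)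
    (hw : w ∈ coneOver Ω) : z + w ∈ coneOver Ω := by
  have hz1 := hz.1
  have hw1 := hw.1
  refine ⟨add_pos hz1 hw1, ?_⟩
  convert hΩ hz.2 hw.2 (a := z.2 / (z.2 + w.2)) (b := w.2 / (z.2 + w.2)) (by positivity)
    (by positivity) (by field_simp) using 1
  simp only [Prod.fst_add, Prod.snd_add, smul_smul, smul_add]
  congr 2 <;> field_simp

theorem continuousAt_inv_smul {z : V × ℝ} (hz : z.2 ≠ 0) :
    ContinuousAt (fun z : V × ℝ => z.2⁻¹ • z.1) z :=
  (continuousAt_snd.inv₀ hz).smul continuousAt_fst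

theorem IsOpen.coneOver (hΩ : IsOpen Ω) : IsOpen (coneOver Ω) := by
  rw [isOpen_iff_mem_nhds]
  intro z hz
  have h : ∀ᶠ w : V × ℝ in 𝓝 z, 0 < w.2 := continuousAt_snd (lt_mem_nhds hz.1)
  exact h.and ((continuousAt_inv_smul hz.1.ne') (hΩ.mem_nhds hz.2))

theorem mem_closure_of_mem_closure_coneOver {x : V} (hx : (x, (1 : ℝ)) ∈ closure (coneOver Ω)) :
    x ∈ closure Ω := by
  have h := (continuousAt_inv_smul (z := (x, (1 : ℝ))) one_ne_zero).continuousWithinAt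
    (s := coneOver Ω) |>.mem_closure_image hx
  rw [inv_one, one_smul] at h
  refine closure_mono ?_ h
  rintro _ ⟨z, hz, rfl⟩
  exact hz.2

/-- The largest linear subspace contained in the closure of the cone over a convex set. -/
def coneLineality (hΩ : Convex ℝ Ω) (hne : Ω.Nonempty) : Submodule ℝ (V × ℝ) where
  carrier := {z | z ∈ closure (coneOver Ω) ∧ -z ∈ closure (coneOver Ω)}
  add_mem' {a b} ha hb := by
    have key : ∀ {a b}, a ∈ closure (coneOver Ω) → b ∈ closure (coneOver Ω) →
        a + b ∈ closure (coneOver Ω) := fun ha hb =>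
      map_mem_closure₂ continuous_add ha hb fun _ h _ h' => hΩ.coneOver_add_mem h h'
    refine ⟨key ha.1 hb.1, ?_⟩
    rw [neg_add]
    exact key ha.2 hb.2
  zero_mem' := by
    have h0 : (0 : V × ℝ) ∈ closure (coneOver Ω) := by
      obtain ⟨x, hx⟩ := hne
      have h : Tendsto (fun t : ℝ => t • (x, (1 : ℝ))) (𝓝[>] 0) (𝓝 ((0 : ℝ) • (x, (1 : ℝ)))) :=
        ((continuous_id.smul continuous_const).tendsto 0).mono_left nhdsWithin_le_nhds
      rw [zero_smul] at h
      refine mem_closure_of_tendsto h ?_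
      filter_upwards [self_mem_nhdsWithin] with t ht
      exact coneOver_smul_mem ht (mem_coneOver_one.2 hx)
    exact ⟨h0, by rwa [neg_zero]⟩
  smul_mem' c z hz := by
    have key : ∀ {t : ℝ} {z}, 0 < t → z ∈ closure (coneOver Ω) → t • z ∈ closure (coneOver Ω) :=
      fun ht hz => map_mem_closure (continuous_const_smul _) hz fun _ h => coneOver_smul_mem ht h
    rcases lt_trichotomy c 0 with hc | rfl | hc
    · refine ⟨?_, ?_⟩
      · rw [← neg_smul_neg]
        exact key (neg_pos.2 hc) hz.2
      · rw [← neg_smul]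
        exact key (neg_pos.2 hc) hz.1
    · have h0 : (0 : V × ℝ) ∈ closure (coneOver Ω) := by
        have h : Tendsto (fun t : ℝ => t • z) (𝓝[>] 0) (𝓝 ((0 : ℝ) • z)) :=
          ((continuous_id.smul continuous_const).tendsto 0).mono_left nhdsWithin_le_nhds
        rw [zero_smul] at h
        refine isClosed_closure.mem_of_tendsto h ?_
        filter_upwards [self_mem_nhdsWithin] with t ht
        exact key ht hz.1
      rw [zero_smul]
      exact ⟨h0, by rwa [neg_zero]⟩
    · refine ⟨key hc hz.1, ?_⟩
      rw [← smul_neg]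
      exact key hc hz.2

/-- The linear map of `V × ℝ` induced by an affine map of `V`. -/
def AffineMap.homogenize (a : V →ᵃ[ℝ] V) : V × ℝ →ₗ[ℝ] V × ℝ :=
  (a.linear.coprod (LinearMap.toSpanSingleton ℝ V (a 0))).prod (LinearMap.snd ℝ V ℝ)

theorem AffineMap.homogenize_one (a : V →ᵃ[ℝ] V) (x : V) : a.homogenize (x, 1) = (a x, 1) := by
  have h : a.linear x + a 0 = a x := (congrFun a.decomp x).symm
  simp [homogenize, h]

theorem AffineMap.homogenize_smul (a : V →ᵃ[ℝ] V) {z : V × ℝ} (hz : z.2 ≠ 0) :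
    a.homogenize z = z.2 • (a (z.2⁻¹ • z.1), (1 : ℝ)) := by
  rw [← homogenize_one, ← map_smul]
  congr 1
  ext <;> simp [hz]

theorem AffineMap.homogenize_image_coneOver {a : V →ᵃ[ℝ] V} (ha : a '' Ω = Ω) :
    a.homogenize '' coneOver Ω = coneOver Ω := by
  ext w
  constructor
  · rintro ⟨z, hz, rfl⟩
    rw [homogenize_smul a hz.1.ne']
    refine coneOver_smul_mem hz.1 (mem_coneOver_one.2 ?_)
    rw [← ha]
    exact mem_image_of_mem _ hz.2
  · intro hw
    have h := hw.2
    rw [← ha] at h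
    obtain ⟨x, hx, hxw⟩ := h
    refine ⟨w.2 • (x, 1), coneOver_smul_mem hw.1 (mem_coneOver_one.2 hx), ?_⟩
    rw [map_smul, homogenize_one, hxw]
    ext <;> simp [hw.1.ne']

theorem AffineMap.surjective_of_image_eq (ho : IsOpen Ω) (hne : Ω.Nonempty) {a : V →ᵃ[ℝ] V}
    (ha : a '' Ω = Ω) : Function.Surjective a := by
  rw [← range_eq_univ]
  have h : affineSpan ℝ Ω = ⊤ := ho.affineSpan_eq_top hne
  have h2 : (affineSpan ℝ Ω).map a = affineSpan ℝ Ω := by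
    rw [AffineSubspace.map_span, ha]
  rw [h] at h2
  rw [← image_univ, ← AffineSubspace.top_coe ℝ V V, ← AffineSubspace.coe_map, h2]

section Quotient

variable {E : Type*} [NormedAddCommGroup E] [NormedSpace ℝ E]
  {q : V × ℝ →L[ℝ] E}

theorem mem_closure_coneOver (hΩ : Convex ℝ Ω) (hq : IsOpenMap q)
    (hker : ∀ z, q z = 0 ↔ z ∈ closure (coneOver Ω) ∧ -z ∈ closure (coneOver Ω)) {z : V × ℝ}
    (hz : q z ∈ closure (q '' coneOver Ω)) : z ∈ closure (coneOver Ω) := by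
  refine closure_minimal ?_ isClosed_closure (hq.preimage_closure_subset_closure_preimage hz)
  rintro w ⟨v, hv, hvw⟩
  have h : w - v ∈ closure (coneOver Ω) := ((hker _).1 (by rw [map_sub, hvw, sub_self])).1
  have h2 := map_mem_closure₂ continuous_add h (subset_closure hv)
    fun _ h _ h' => hΩ.coneOver_add_mem h h'
  rwa [sub_add_cancel] at h2

/-- The quotient of the cone over an open convex set by the lineality space of its closure. -/
def quotientCone (hΩ : Convex ℝ Ω) (ho : IsOpen Ω) (hne : Ω.Nonempty) (hq : IsOpenMap q)
    (hker : ∀ z, q z = 0 ↔ z ∈ closure (coneOver Ω) ∧ -z ∈ closure (coneOver Ω))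
    (hsurj : Function.Surjective q) (e : E →L[ℝ] ℝ) (he : ∀ z, e (q z) = z.2) : PosCone E where
  O := q '' coneOver Ω
  e := e
  isOpen := hq _ ho.coneOver
  nonempty := by
    obtain ⟨x, hx⟩ := hne
    exact ⟨_, _, mem_coneOver_one.2 hx, rfl⟩
  smul_mem := by
    rintro t _ ht ⟨z, hz, rfl⟩
    exact ⟨t • z, coneOver_smul_mem ht hz, map_smul _ _ _⟩
  add_mem := by
    rintro _ _ ⟨z, hz, rfl⟩ ⟨w, hw, rfl⟩
    exact ⟨z + w, hΩ.coneOver_add_mem hz hw, map_add _ _ _⟩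
  e_pos := by
    rintro _ ⟨z, hz, rfl⟩
    rw [he]
    exact hz.1
  pointed := by
    intro x hx hx'
    obtain ⟨z, rfl⟩ := hsurj x
    rw [← map_neg] at hx'
    exact (hker z).2 ⟨mem_closure_coneOver hΩ hq hker hx, mem_closure_coneOver hΩ hq hker hx'⟩

theorem exists_aut_homogenize [FiniteDimensional ℝ V] [FiniteDimensional ℝ E] {S : PosCone E}
    (hO : S.O = q '' coneOver Ω) (hS : ∀ z, S.e (q z) = z.2) (hsurj : Function.Surjective q)
    (hker : ∀ z, q z = 0 ↔ z ∈ closure (coneOver Ω) ∧ -z ∈ closure (coneOver Ω))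
    {a : V →ᵃ[ℝ] V} (ha : a '' Ω = Ω) : ∃ g ∈ S.Aut, ∀ z, g (q z) = q (a.homogenize z) := by
  obtain ⟨r, hr⟩ := LinearMap.exists_rightInverse_of_surjective q.toLinearMap
    (LinearMap.range_eq_top.2 hsurj)
  have hr' : ∀ x, q (r x) = x := fun x => DFunLike.congr_fun hr x
  have hD : ∀ z ∈ closure (coneOver Ω), a.homogenize z ∈ closure (coneOver Ω) := fun z hz =>
    map_mem_closure a.homogenize.continuous_of_finiteDimensional hz fun w hw => by
      rw [← AffineMap.homogenize_image_coneOver ha]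
      exact mem_image_of_mem _ hw
  have hg : ∀ z, q (a.homogenize (r (q z))) = q (a.homogenize z) := by
    intro z
    have h := (hker (r (q z) - z)).1 (by rw [map_sub, hr', sub_self])
    have h2 := (hker (a.homogenize (r (q z) - z))).2 ⟨hD _ h.1, by
      rw [← map_neg]
      exact hD _ h.2⟩
    rwa [map_sub, map_sub, sub_eq_zero] at h2
  have himage : (fun x => q (a.homogenize (r x))) '' S.O = S.O := by
    rw [hO, image_image]
    simp only [hg]
    rw [← image_image q, AffineMap.homogenize_image_coneOver ha]
  let g : E →L[ℝ] E := LinearMap.toContinuousLinearMap (q.toLinearMap ∘ₗ a.homogenize ∘ₗ r)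
  refine ⟨g, ⟨?_, ?_, himage⟩, hg⟩
  · rw [ContinuousLinearMap.isUnit_iff_bijective]
    have hs : Function.Surjective g.toLinearMap := by
      rw [← LinearMap.range_eq_top]
      refine Submodule.eq_top_of_nonempty_interior' _ ?_
      obtain ⟨x, hx⟩ := S.nonempty
      refine ⟨x, mem_interior.2 ⟨S.O, ?_, S.isOpen, hx⟩⟩
      rw [← himage]
      rintro _ ⟨x, -, rfl⟩
      exact ⟨x, rfl⟩
    exact ⟨LinearMap.injective_iff_surjective.2 hs, hs⟩
  · ext x
    obtain ⟨z, rfl⟩ := hsurj x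
    show S.e (q (a.homogenize (r (q z)))) = S.e (q z)
    rw [hg, hS, hS]
    rfl

/-- An irreducible quasi-homogeneous convex domain is, modulo the lineality space of its cone and
up to the boundary, the convex hull of a polynomially parametrized set. -/
theorem exists_polynomial_slice [FiniteDimensional ℝ V] [FiniteDimensional ℝ E]
    (hΩ : Convex ℝ Ω) (ho : IsOpen Ω)
    (hne : Ω.Nonempty) {K : Set V} (hK : IsCompact K) (hKΩ : K ⊆ Ω)
    (hcov : ∀ x ∈ Ω, ∃ a : V →ᵃ[ℝ] V, a '' Ω = Ω ∧ ∃ k ∈ K, a k = x)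
    (hirr : ∀ S : AffineSubspace ℝ V, (S : Set V).Nonempty →
      (∀ a : V →ᵃ[ℝ] V, a '' Ω = Ω → a '' (S : Set V) = S) → (S : Set V) = univ)
    (hsurj : Function.Surjective q)
    (hker : ∀ z, q z = 0 ↔ z ∈ closure (coneOver Ω) ∧ -z ∈ closure (coneOver Ω)) :
    ∃ (d : ℕ) (y : (Fin d → ℝ) → E), IsPolynomialMap y ∧
      (∀ x ∈ Ω, q (x, 1) ∈ convexHull ℝ (range y)) ∧
      ∀ x, q (x, 1) ∈ convexHull ℝ (range y) → x ∈ closure Ω := by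
  obtain ⟨r, hr⟩ := LinearMap.exists_rightInverse_of_surjective q.toLinearMap
    (LinearMap.range_eq_top.2 hsurj)
  have hr' : ∀ x, q (r x) = x := fun x => DFunLike.congr_fun hr x
  have hqo : IsOpenMap q := q.isOpenMap hsurj
  have hnonneg : ∀ z ∈ closure (coneOver Ω), 0 ≤ z.2 := fun z hz =>
    closure_minimal (fun w hw => hw.1.le) (isClosed_le continuous_const continuous_snd) hz
  have he : ∀ z, (r (q z)).2 = z.2 := by
    intro z
    have h := (hker (r (q z) - z)).1 (by rw [map_sub, hr', sub_self])
    have h1 := hnonneg _ h.1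
    have h2 := hnonneg _ h.2
    simp only [Prod.snd_sub, Prod.snd_neg] at h1 h2
    linarith
  let S := quotientCone hΩ ho hne hqo hker hsurj
    (LinearMap.toContinuousLinearMap (LinearMap.snd ℝ V ℝ ∘ₗ r)) he
  have hSe : ∀ z, S.e (q z) = z.2 := he
  have haut : ∀ {a : V →ᵃ[ℝ] V}, a '' Ω = Ω → ∃ g ∈ S.Aut, ∀ z, g (q z) = q (a.homogenize z) :=
    fun ha => exists_aut_homogenize rfl hSe hsurj hker ha
  have hslice : ∀ z : V × ℝ, z.2 = 1 → z = (z.1, 1) := fun z hz => by rw [← hz]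
  have hSK : S.IsCocompact ((fun x => q (x, 1)) '' K) := by
    refine ⟨hK.image (by fun_prop), ?_, ?_⟩
    · rintro _ ⟨x, hx, rfl⟩
      exact ⟨_, mem_coneOver_one.2 (hKΩ hx), rfl⟩
    · rintro _ ⟨z, hz, rfl⟩ hz1
      rw [hSe] at hz1
      rw [hslice z hz1, mem_coneOver_one] at hz
      obtain ⟨a, ha, k, hk, hkz⟩ := hcov _ hz
      obtain ⟨g, hg, hgq⟩ := haut ha
      refine ⟨_, PosCone.Aut.inv hg, k, hk, ?_⟩
      beta_reduce
      rw [hslice z hz1, ← hkz, ← a.homogenize_one, ← hgq, PosCone.Aut.inv_apply hg]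
  have hSirr : S.IsIrred := by
    rintro F hF ⟨x, hxF, hx1⟩
    let f : V →ᵃ[ℝ] E := (q.toLinearMap ∘ₗ LinearMap.inl ℝ V ℝ).toAffineMap +
      AffineMap.const ℝ V (q (0, 1))
    have hf : ∀ v, f v = q (v, 1) := by
      intro v
      show q (v, 0) + q (0, 1) = _
      rw [← map_add, Prod.mk_add_mk, add_zero, zero_add]
    have hmem : ∀ v, v ∈ ((F.toAffineSubspace.comap f : AffineSubspace ℝ V) : Set V) ↔
        q (v, 1) ∈ F := by
      intro v
      rw [← hf]
      rfl
    have huniv := hirr (F.toAffineSubspace.comap f) ?_ fun a ha => ?_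
    · have hv : ∀ v, q (v, 1) ∈ F := fun v => (hmem v).1 (huniv ▸ mem_univ v)
      rw [eq_top_iff]
      intro w _
      obtain ⟨z, rfl⟩ := hsurj w
      have hz : z = (z.1, (1 : ℝ)) + (z.2 - 1) • ((0 : V), (1 : ℝ)) := by ext <;> simp
      rw [hz, map_add, map_smul]
      exact F.add_mem (hv _) (F.smul_mem _ (hv _))
    · obtain ⟨z, rfl⟩ := hsurj x
      rw [hSe] at hx1
      rw [hslice z hx1] at hxF
      exact ⟨z.1, (hmem _).2 hxF⟩
    · obtain ⟨g, hg, hgq⟩ := haut ha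
      ext w
      constructor
      · rintro ⟨v, hv, rfl⟩
        rw [hmem] at hv ⊢
        rw [← a.homogenize_one, ← hgq]
        exact hF g hg _ hv
      · intro hw
        rw [hmem] at hw
        obtain ⟨v, rfl⟩ := AffineMap.surjective_of_image_eq ho hne ha w
        refine ⟨v, (hmem _).2 ?_, rfl⟩
        have h := hF _ (PosCone.Aut.inv hg) _ hw
        rwa [← a.homogenize_one, ← hgq, PosCone.Aut.inv_apply hg] at h
  obtain ⟨N, p, hN, hNp, hO⟩ := hSK.exists_nilpotent hSirr
  obtain ⟨d, y, hy, hrange⟩ := exists_isPolynomialMap_exp N p hN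
  refine ⟨d, y, hy, fun x hx => ?_, fun x hx => ?_⟩
  · rw [hrange]
    exact hO _ ⟨_, mem_coneOver_one.2 hx, rfl⟩ (hSe _)
  · refine mem_closure_of_mem_closure_coneOver (mem_closure_coneOver hΩ hqo hker ?_)
    refine convexHull_min ?_ S.convex_D hx
    rw [hrange]
    rintro _ ⟨X, hX, rfl⟩
    exact (hNp X hX).1

end Quotient

end ConeOver

/-- The affine action of a matrix as an affine map. -/
def affActMap (n : ℕ) (g : GL (Fin (n + 1)) ℝ) : (Fin n → ℝ) →ᵃ[ℝ] (Fin n → ℝ) :=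
  (Matrix.of fun i j : Fin n => g.val i.castSucc j.castSucc).mulVecLin.toAffineMap +
    AffineMap.const ℝ _ fun i => g.val i.castSucc (Fin.last n)

theorem IsConvexDomain.isSemialgebraic {n : ℕ} {Ω : Set (Fin n → ℝ)} (hdom : IsConvexDomain n Ω)
    (hqh : IsQuasiHomogeneous n Ω) (hirr : IsIrreducibleAut n Ω) : IsSemialgebraic n Ω := by
  obtain ⟨hne, ho, hΩ⟩ := hdom
  obtain ⟨K, hK, hKΩ, hcov⟩ := hqh
  have haff : ∀ x ∈ Ω, ∃ a : (Fin n → ℝ) →ᵃ[ℝ] (Fin n → ℝ), a '' Ω = Ω ∧ ∃ k ∈ K, a k = x := by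
    intro x hx
    rw [← hcov, mem_iUnion₂] at hx
    obtain ⟨g, hg, k, hk, hkx⟩ := hx
    exact ⟨affActMap n g, hg.2, k, hk, hkx⟩
  have hinv : ∀ S : AffineSubspace ℝ (Fin n → ℝ), (S : Set (Fin n → ℝ)).Nonempty →
      (∀ a : (Fin n → ℝ) →ᵃ[ℝ] (Fin n → ℝ), a '' Ω = Ω → a '' (S : Set (Fin n → ℝ)) = S) →
      (S : Set (Fin n → ℝ)) = univ := by
    intro S hS hinv
    by_contra hSu
    exact hirr ⟨S, hS, hSu, fun g hg => hinv (affActMap n g) hg.2⟩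
  have : IsClosed (coneLineality hΩ hne : Set ((Fin n → ℝ) × ℝ)) :=
    Submodule.closed_of_finiteDimensional _
  let q : (Fin n → ℝ) × ℝ →L[ℝ] ((Fin n → ℝ) × ℝ) ⧸ coneLineality hΩ hne :=
    LinearMap.toContinuousLinearMap (Submodule.mkQ _)
  obtain ⟨d, y, hy, h1, h2⟩ := exists_polynomial_slice hΩ ho hne hK hKΩ haff hinv
    (q := q) (Submodule.mkQ_surjective _) fun z => Submodule.Quotient.mk_eq_zero _
  have hq : IsPolynomialMap fun w => q (w, 1) := by
    convert IsPolynomialMap.of_linearMap (q.toLinearMap ∘ₗ LinearMap.inl ℝ _ ℝ) (q (0, 1))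
      using 2 with w
    show _ = q (w, 0) + q (0, 1)
    rw [← map_add, Prod.mk_add_mk, add_zero, zero_add]
  have hint : interior {w | q (w, 1) ∈ convexHull ℝ (range y)} = Ω := by
    apply subset_antisymm
    · refine (interior_mono h2).trans ?_
      rw [hΩ.interior_closure_eq_interior_of_nonempty_interior (by rwa [ho.interior_eq]),
        ho.interior_eq]
    · exact interior_maximal h1 ho
  have h := (IsSignDetermined.mem_interior
    (Z := {w | q (w, 1) ∈ convexHull ℝ (range y)})
    (IsSignDetermined.mem_convexHull hy hq)).isSemialgebraic
  simpa only [hint, Set.ofPred_mem_eq] using h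

/-- a convex quasi-homogeneous affine domain Ω ⊊ ℝⁿ with irreducible
Aut(Ω) and nonempty Λ_{Aut⁰(Ω)} is semi-algebraic. -/
theorem semialgebraic_of_irreducible_limitSet_nonempty (n : ℕ) (Ω : Set (Fin n → ℝ))
    (hdom : IsConvexDomain n Ω) (h2 : IsQuasiHomogeneous n Ω)
    (hproper : Ω ≠ Set.univ)
    (h3 : IsIrreducibleAut n Ω)
    (h4 : (limitSet n Ω (AutIdComp n Ω)).Nonempty) :
    IsSemialgebraic n Ω :=
  hdom.isSemialgebraic h2 h3
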